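/- Let d ≥ 1, N ≥ 1, let Q ⊂ ℝ^d be a cube of volume |Q|, and let u ∈ C_c^∞((ℝ^d)^N; ℂ). Define ρ(x) := ∑_{j=1}^N ∫_{(ℝ^d)^{N−1}} |u(x_1,…,x_{j−1}, x, x_{j+1},…,x_N)|² ∏_{k≠j} dx_k, and assume ∫_Q ρ > 0. Then ∑_{j=1}^N ∫_{(ℝ^d)^N} ‖∇_j u‖² · χ_Q(x_j) dx ≥ ( C′_d / (∫_Q ρ)^{2/d} ) · ∫_Q [ ρ(x)^{1/2} − (∫_Q ρ / |Q|)^{1/2} ]₊^{2(d+2)/d} dx, where C′_1 = π²/60 and C′_d = (π²/4)·d^{2−2/d}/((d+2)(d+4)) for d ≥ 2, and [t]₊ := max(t, 0). -/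

import Mathlib

open MeasureTheory

/-- `∫ |u|²` over all particle coordinates except the `j`-th one, which is set to `y`. -/
noncomputable def densityAt {d N : ℕ} (u : (Fin N → EuclideanSpace ℝ (Fin d)) → ℂ)
    (j : Fin N) (y : EuclideanSpace ℝ (Fin d)) : ℝ :=
  ∫ z : {k : Fin N // k ≠ j} → EuclideanSpace ℝ (Fin d),
    ‖u (fun k => if h : k = j then y else z ⟨k, h⟩)‖ ^ 2

/-- Coefficients with `#{k ∈ ℤ^d : |k| ≤ R} ≤ ∑ m, (d choose m) * latticeCoeff m * R ^ m`. -/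
noncomputable def latticeCoeff : ℕ → ℝ
  | 0 => 1
  | 1 => 2
  | 2 => 4
  | 3 => 16 / 3
  | 4 => 64 / 9
  | 5 => 1024 / 135
  | _ => 16384 / 2025

theorem latticeCoeff_nonneg (m : ℕ) : 0 ≤ latticeCoeff m := by
  unfold latticeCoeff; split <;> norm_num

/-- Multiplicity of a nonnegative integer as the absolute value of an integer. -/
def absMult (k : ℕ) : ℝ := if k = 0 then 1 else 2

theorem absMult_nonneg (k : ℕ) : 0 ≤ absMult k := by
  unfold absMult; split_ifs <;> norm_num

/-- A Riemann sum of `(1 - t ^ 2 / R ^ 2) ^ j` is bounded by the integral. -/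
theorem sum_one_sub_sq_pow_le_integral {R : ℝ} (hR : 0 < R) (j n : ℕ) (hn : (n : ℝ) ≤ R) :
    ∑ k ∈ Finset.range n, (1 - ((k : ℝ) + 1) ^ 2 / R ^ 2) ^ j
      ≤ ∫ t in (0 : ℝ)..R, (1 - t ^ 2 / R ^ 2) ^ j := by
  have hnn : ∀ t ∈ Set.Icc 0 R, 0 ≤ 1 - t ^ 2 / R ^ 2 := by
    intro t ht
    rw [sub_nonneg, div_le_one (by positivity)]
    exact pow_le_pow_left₀ ht.1 ht.2 2
  have hanti : AntitoneOn (fun t : ℝ => (1 - t ^ 2 / R ^ 2) ^ j) (Set.Icc 0 (0 + (n : ℝ))) := by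
    intro x hx y hy hxy
    rw [zero_add] at hx hy
    refine pow_le_pow_left₀ (hnn y ⟨hy.1, hy.2.trans hn⟩) ?_ j
    have := pow_le_pow_left₀ hx.1 hxy 2
    gcongr
  have h1 := hanti.sum_le_integral
  have hc : Continuous fun t : ℝ => (1 - t ^ 2 / R ^ 2) ^ j := by fun_prop
  have h2 : ∫ t in (0 : ℝ)..(0 + n : ℝ), (1 - t ^ 2 / R ^ 2) ^ j
      ≤ ∫ t in (0 : ℝ)..R, (1 - t ^ 2 / R ^ 2) ^ j := by
    rw [zero_add, ← intervalIntegral.integral_add_adjacent_intervals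
      (hc.intervalIntegrable 0 n) (hc.intervalIntegrable n R)]
    refine le_add_of_nonneg_right (intervalIntegral.integral_nonneg hn fun t ht => ?_)
    exact pow_nonneg (hnn t ⟨(Nat.cast_nonneg n).trans ht.1, ht.2⟩) j
  refine le_trans (le_of_eq ?_) (h1.trans h2)
  simp

theorem two_mul_sum_one_sub_sq_pow_le {R : ℝ} (hR : 0 < R) (n : ℕ) (hn : (n : ℝ) ≤ R) :
    2 * ∑ k ∈ Finset.range n, (1 - ((k : ℝ) + 1) ^ 2 / R ^ 2) ^ 0 ≤ 2 * R ∧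
    2 * ∑ k ∈ Finset.range n, (1 - ((k : ℝ) + 1) ^ 2 / R ^ 2) ^ 1 ≤ 4 / 3 * R ∧
    2 * ∑ k ∈ Finset.range n, (1 - ((k : ℝ) + 1) ^ 2 / R ^ 2) ^ 2 ≤ 16 / 15 * R ∧
    2 * ∑ k ∈ Finset.range n, (1 - ((k : ℝ) + 1) ^ 2 / R ^ 2) ^ 3 ≤ R := by
  have key (j : ℕ) (F : ℝ → ℝ) (hF : ∀ t, HasDerivAt F ((1 - t ^ 2 / R ^ 2) ^ j) t) :
      ∑ k ∈ Finset.range n, (1 - ((k : ℝ) + 1) ^ 2 / R ^ 2) ^ j ≤ F R - F 0 := by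
    refine (sum_one_sub_sq_pow_le_integral hR j n hn).trans (le_of_eq ?_)
    exact intervalIntegral.integral_eq_sub_of_hasDerivAt (fun t _ => hF t)
      (Continuous.intervalIntegrable (by fun_prop) _ _)
  have hmon (a : ℝ) (m : ℕ) (t : ℝ) : HasDerivAt (fun t => a * t ^ m) (a * (m * t ^ (m - 1))) t :=
    (hasDerivAt_pow m t).const_mul a
  refine ⟨?_, ?_, ?_, ?_⟩
  · simpa using hn
  · have := key 1 (fun t => 1 * t ^ 1 + (-(1 / (3 * R ^ 2))) * t ^ 3) fun t => by
      refine ((hmon 1 1 t).add (hmon (-(1 / (3 * R ^ 2))) 3 t)).congr_deriv ?_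
      push_cast
      field_simp
      ring
    refine (mul_le_mul_of_nonneg_left this zero_le_two).trans (le_of_eq ?_)
    field_simp
    ring
  · have := key 2 (fun t => 1 * t ^ 1 + (-(2 / (3 * R ^ 2))) * t ^ 3 + 1 / (5 * R ^ 4) * t ^ 5)
      fun t => by
        refine (((hmon 1 1 t).add (hmon (-(2 / (3 * R ^ 2))) 3 t)).add
          (hmon (1 / (5 * R ^ 4)) 5 t)).congr_deriv ?_
        push_cast
        field_simp
        ring
    refine (mul_le_mul_of_nonneg_left this zero_le_two).trans (le_of_eq ?_)
    field_simp
    ring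
  · have := key 3 (fun t => 1 * t ^ 1 + (-(1 / R ^ 2)) * t ^ 3 + 3 / (5 * R ^ 4) * t ^ 5
        + (-(1 / (7 * R ^ 6))) * t ^ 7) fun t => by
      refine ((((hmon 1 1 t).add (hmon (-(1 / R ^ 2)) 3 t)).add
        (hmon (3 / (5 * R ^ 4)) 5 t)).add (hmon (-(1 / (7 * R ^ 6))) 7 t)).congr_deriv ?_
      push_cast
      field_simp
      ring
    refine (mul_le_mul_of_nonneg_left this zero_le_two).trans ?_
    have e : (2 : ℝ) * ((1 * R ^ 1 + (-(1 / R ^ 2)) * R ^ 3 + 3 / (5 * R ^ 4) * R ^ 5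
        + (-(1 / (7 * R ^ 6))) * R ^ 7) - (1 * 0 ^ 1 + (-(1 / R ^ 2)) * 0 ^ 3
        + 3 / (5 * R ^ 4) * 0 ^ 5 + (-(1 / (7 * R ^ 6))) * 0 ^ 7)) = 32 / 35 * R := by
      field_simp
      ring
    rw [e]
    linarith

theorem latticeCoeff_mul_sum_sqrt_pow_le {R : ℝ} (hR : 0 < R) (n : ℕ) (hn : (n : ℝ) ≤ R) (m : ℕ) :
    latticeCoeff m * (2 * ∑ k ∈ Finset.range n, √(R ^ 2 - ((k : ℝ) + 1) ^ 2) ^ m)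
      ≤ latticeCoeff (m + 1) * R ^ (m + 1) := by
  have hterm (j : ℕ) (hj : 2 * j ≤ m) (k : ℕ) (hk : k ∈ Finset.range n) :
      √(R ^ 2 - ((k : ℝ) + 1) ^ 2) ^ m ≤ R ^ m * (1 - ((k : ℝ) + 1) ^ 2 / R ^ 2) ^ j := by
    have hk' : (k : ℝ) + 1 ≤ R := by
      have : ((k + 1 : ℕ) : ℝ) ≤ n := by exact_mod_cast Finset.mem_range.1 hk
      push_cast at this
      linarith
    have hq : 0 ≤ R ^ 2 - ((k : ℝ) + 1) ^ 2 := sub_nonneg.2 (pow_le_pow_left₀ (by positivity) hk' 2)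
    have hle : √(R ^ 2 - ((k : ℝ) + 1) ^ 2) ≤ R :=
      Real.sqrt_le_iff.2 ⟨hR.le, by nlinarith [sq_nonneg ((k : ℝ) + 1)]⟩
    obtain ⟨l, rfl⟩ := Nat.exists_eq_add_of_le hj
    rw [pow_add, pow_mul, Real.sq_sqrt hq]
    have e : R ^ (2 * j + l) * (1 - ((k : ℝ) + 1) ^ 2 / R ^ 2) ^ j
        = (R ^ 2 - ((k : ℝ) + 1) ^ 2) ^ j * R ^ l := by
      rw [pow_add, pow_mul, mul_right_comm, ← mul_pow]
      congr 2
      field_simp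
    rw [e]
    gcongr
  have hsum (j : ℕ) (hj : 2 * j ≤ m) (γ : ℝ)
      (h : 2 * ∑ k ∈ Finset.range n, (1 - ((k : ℝ) + 1) ^ 2 / R ^ 2) ^ j ≤ γ * R)
      (hγ : latticeCoeff (m + 1) = latticeCoeff m * γ) :
      latticeCoeff m * (2 * ∑ k ∈ Finset.range n, √(R ^ 2 - ((k : ℝ) + 1) ^ 2) ^ m)
        ≤ latticeCoeff (m + 1) * R ^ (m + 1) := by
    rw [hγ, mul_assoc]
    refine mul_le_mul_of_nonneg_left ?_ (latticeCoeff_nonneg m)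
    calc _ ≤ 2 * ∑ k ∈ Finset.range n, R ^ m * (1 - ((k : ℝ) + 1) ^ 2 / R ^ 2) ^ j := by
            gcongr with k hk
            exact hterm j hj k hk
      _ = R ^ m * (2 * ∑ k ∈ Finset.range n, (1 - ((k : ℝ) + 1) ^ 2 / R ^ 2) ^ j) := by
            rw [← Finset.mul_sum]; ring
      _ ≤ R ^ m * (γ * R) := by gcongr
      _ = _ := by ring
  obtain ⟨h0, h1, h2, h3⟩ := two_mul_sum_one_sub_sq_pow_le hR n hn
  match m with
  | 0 => exact hsum 0 (by norm_num) 2 h0 (by norm_num [latticeCoeff])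
  | 1 => exact hsum 0 (by norm_num) 2 h0 (by norm_num [latticeCoeff])
  | 2 => exact hsum 1 (by norm_num) (4 / 3) h1 (by norm_num [latticeCoeff])
  | 3 => exact hsum 1 (by norm_num) (4 / 3) h1 (by norm_num [latticeCoeff])
  | 4 => exact hsum 2 (by norm_num) (16 / 15) h2 (by norm_num [latticeCoeff])
  | 5 => exact hsum 2 (by norm_num) (16 / 15) h2 (by norm_num [latticeCoeff])
  | m + 6 => exact hsum 3 (by omega) 1 (by simpa using h3) (mul_one _).symm

/-- Bound for the number of integer points in a ball of radius `R`, counted through the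
absolute values of the coordinates. -/
theorem sum_prod_absMult_le (d : ℕ) : ∀ (R : ℝ), 0 ≤ R → ∀ S : Finset (Fin d → ℕ),
    (∀ k ∈ S, ∑ i, (k i : ℝ) ^ 2 ≤ R ^ 2) →
    ∑ k ∈ S, ∏ i, absMult (k i)
      ≤ ∑ m ∈ Finset.range (d + 1), (d.choose m : ℝ) * (latticeCoeff m * R ^ m) := by
  induction d with
  | zero =>
    intro R _ S _
    have : S.card ≤ 1 := Finset.card_le_one.2 fun a _ b _ => Subsingleton.elim a b
    simpa [latticeCoeff] using (by exact_mod_cast this : (S.card : ℝ) ≤ 1)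
  | succ d ih =>
    intro R hR S hS
    set n := ⌊R⌋₊ with hn
    have hk0 : ∀ k ∈ S, k 0 ∈ Finset.range (n + 1) := by
      intro k hk
      rw [Finset.mem_range, Nat.lt_succ_iff, hn]
      refine Nat.le_floor (le_of_sq_le_sq ?_ hR)
      exact (Finset.single_le_sum (f := fun i => (k i : ℝ) ^ 2) (fun i _ => sq_nonneg _)
        (Finset.mem_univ 0)).trans (hS k hk)
    have hfib (a : ℕ) (ha : (a : ℝ) ≤ R) : ∑ k ∈ S with k 0 = a, ∏ i, absMult (k i)
        ≤ absMult a * ∑ m ∈ Finset.range (d + 1),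
          (d.choose m : ℝ) * (latticeCoeff m * √(R ^ 2 - (a : ℝ) ^ 2) ^ m) := by
      have hinj : Set.InjOn (Fin.tail : (Fin (d + 1) → ℕ) → Fin d → ℕ)
          (S.filter fun k => k 0 = a) := by
        intro k hk l hl h
        have hk' := (Finset.mem_filter.1 hk).2
        have hl' := (Finset.mem_filter.1 hl).2
        rw [← Fin.cons_self_tail k, ← Fin.cons_self_tail l, h, hk', hl']
      have := ih √(R ^ 2 - (a : ℝ) ^ 2) (Real.sqrt_nonneg _)
        ((S.filter fun k => k 0 = a).image Fin.tail) (by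
          intro k hk
          obtain ⟨l, hl, rfl⟩ := Finset.mem_image.1 hk
          obtain ⟨hl, hla⟩ := Finset.mem_filter.1 hl
          have := hS l hl
          rw [Fin.sum_univ_succ, hla] at this
          rw [Real.sq_sqrt (sub_nonneg.2 (pow_le_pow_left₀ (Nat.cast_nonneg a) ha 2))]
          simp only [Fin.tail]
          linarith)
      rw [Finset.sum_image hinj] at this
      refine le_trans (le_of_eq ?_) (mul_le_mul_of_nonneg_left this (absMult_nonneg a))
      rw [Finset.mul_sum]
      refine Finset.sum_congr rfl fun k hk => ?_
      rw [Fin.prod_univ_succ, (Finset.mem_filter.1 hk).2]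
      rfl
    have hnR : (n : ℝ) ≤ R := Nat.floor_le hR
    rw [← Finset.sum_fiberwise_of_maps_to hk0]
    calc _ ≤ ∑ a ∈ Finset.range (n + 1), absMult a * ∑ m ∈ Finset.range (d + 1),
          (d.choose m : ℝ) * (latticeCoeff m * √(R ^ 2 - (a : ℝ) ^ 2) ^ m) := by
            refine Finset.sum_le_sum fun a ha => hfib a (le_trans ?_ hnR)
            exact_mod_cast Nat.lt_succ_iff.1 (Finset.mem_range.1 ha)
      _ = ∑ m ∈ Finset.range (d + 1), (d.choose m : ℝ) * (latticeCoeff m * R ^ m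
            + latticeCoeff m * (2 * ∑ k ∈ Finset.range n, √(R ^ 2 - ((k : ℝ) + 1) ^ 2) ^ m)) := by
            rw [Finset.sum_range_succ']
            simp only [absMult, Nat.add_eq_zero_iff, one_ne_zero, and_false, if_false, if_true,
              Finset.mul_sum, Nat.cast_zero, one_mul, mul_add, Finset.sum_add_distrib]
            rw [Finset.sum_comm, add_comm]
            congr 1
            · refine Finset.sum_congr rfl fun m _ => ?_
              rw [zero_pow two_ne_zero, sub_zero, Real.sqrt_sq hR]
            · refine Finset.sum_congr rfl fun m _ => Finset.sum_congr rfl fun k _ => ?_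
              push_cast
              ring
      _ ≤ ∑ m ∈ Finset.range (d + 1), (d.choose m : ℝ) * (latticeCoeff m * R ^ m
            + latticeCoeff (m + 1) * R ^ (m + 1)) := by
            refine Finset.sum_le_sum fun m _ => ?_
            have : latticeCoeff m * (2 * ∑ k ∈ Finset.range n, √(R ^ 2 - ((k : ℝ) + 1) ^ 2) ^ m)
                ≤ latticeCoeff (m + 1) * R ^ (m + 1) := by
              rcases hR.eq_or_lt with h | h
              · have : n = 0 := by rw [hn, ← h, Nat.floor_zero]
                rw [this, ← h]
                simp
              · exact latticeCoeff_mul_sum_sqrt_pow_le h n hnR m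
            gcongr
      _ = _ := by
            rw [Finset.sum_choose_succ_mul (fun m _ => latticeCoeff m * R ^ m) d, add_comm]
            simp only [mul_add, Finset.sum_add_distrib]

theorem sum_choose_mul_latticeCoeff_le (d : ℕ) (hd : 1 ≤ d) :
    ∑ m ∈ Finset.range d, (d.choose (m + 1) : ℝ) * latticeCoeff (m + 1) ≤ d * 2 ^ d := by
  rcases lt_or_ge d 9 with h | h
  · interval_cases d <;>
      norm_num [Finset.sum_range_succ, latticeCoeff, Nat.choose]
  · have hc (m : ℕ) : latticeCoeff m ≤ 9 := by
      unfold latticeCoeff; split <;> norm_num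
    have hs : ∑ m ∈ Finset.range d, (d.choose (m + 1) : ℝ) ≤ 2 ^ d := by
      have := Nat.sum_range_choose d
      rw [Finset.sum_range_succ'] at this
      exact_mod_cast (Nat.le_add_right _ _).trans this.le
    calc _ ≤ ∑ m ∈ Finset.range d, (d.choose (m + 1) : ℝ) * 9 := by gcongr; exact hc _
      _ = 9 * ∑ m ∈ Finset.range d, (d.choose (m + 1) : ℝ) := by
          rw [← Finset.sum_mul, mul_comm]
      _ ≤ d * 2 ^ d := by
          gcongr
          exact_mod_cast h

/-- A ball of radius `R` contains at most `d * (2 * R) ^ d` nonzero integer points. -/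
theorem sum_prod_absMult_nonzero_le {d : ℕ} (hd : 1 ≤ d) {R : ℝ} (hR : 0 ≤ R)
    (S : Finset (Fin d → ℕ)) (hS : ∀ k ∈ S, ∑ i, (k i : ℝ) ^ 2 ≤ R ^ 2) (h0 : 0 ∉ S) :
    ∑ k ∈ S, ∏ i, absMult (k i) ≤ d * (2 * R) ^ d := by
  rcases lt_or_ge R 1 with h1 | h1
  · have : S = ∅ := by
      refine Finset.eq_empty_of_forall_notMem fun k hk => h0 ?_
      convert hk
      symm
      funext i
      by_contra hi
      have h2 : (1 : ℝ) ≤ (k i : ℝ) ^ 2 := by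
        exact_mod_cast Nat.one_le_pow _ _ (Nat.pos_of_ne_zero hi)
      have h3 := (Finset.single_le_sum (f := fun i => (k i : ℝ) ^ 2) (fun i _ => sq_nonneg _)
        (Finset.mem_univ i)).trans (hS k hk)
      nlinarith
    rw [this, Finset.sum_empty]
    positivity
  · have h := sum_prod_absMult_le d R hR (insert 0 S) (by
      intro k hk
      rcases Finset.mem_insert.1 hk with rfl | hk
      · simpa using sq_nonneg R
      · exact hS k hk)
    rw [Finset.sum_insert h0, Finset.sum_range_succ'] at h
    have hz : ∏ i : Fin d, absMult ((0 : Fin d → ℕ) i) = 1 := by simp [absMult]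
    rw [hz] at h
    have h' : ∑ k ∈ S, ∏ i, absMult (k i) ≤ ∑ m ∈ Finset.range d,
        (d.choose (m + 1) : ℝ) * (latticeCoeff (m + 1) * R ^ (m + 1)) := by
      have hc : latticeCoeff 0 = 1 := rfl
      rw [Nat.choose_zero_right, hc, pow_zero, Nat.cast_one] at h
      linarith
    refine h'.trans ?_
    calc _ ≤ ∑ m ∈ Finset.range d, (d.choose (m + 1) : ℝ) * (latticeCoeff (m + 1) * R ^ d) := by
            refine Finset.sum_le_sum fun m hm => ?_
            have := pow_le_pow_right₀ h1 (Nat.succ_le_of_lt (Finset.mem_range.1 hm))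
            have := latticeCoeff_nonneg (m + 1)
            gcongr
      _ = (∑ m ∈ Finset.range d, (d.choose (m + 1) : ℝ) * latticeCoeff (m + 1)) * R ^ d := by
            rw [Finset.sum_mul]
            exact Finset.sum_congr rfl fun m _ => by ring
      _ ≤ d * 2 ^ d * R ^ d := by
            gcongr
            exact sum_choose_mul_latticeCoeff_le d hd
      _ = _ := by ring

/-- The normalized one-dimensional Neumann eigenfunctions on `[c, c + s]`. -/
noncomputable def cosMode (c s : ℝ) (k : ℕ) (t : ℝ) : ℝ :=
  √(absMult k / s) * Real.cos (Real.pi * k / s * (t - c))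

/-- The derivative of `cosMode`. -/
noncomputable def cosModeDeriv (c s : ℝ) (k : ℕ) (t : ℝ) : ℝ :=
  √(absMult k / s) * (-(Real.pi * k / s) * Real.sin (Real.pi * k / s * (t - c)))

theorem hasDerivAt_cosMode (c s : ℝ) (k : ℕ) (t : ℝ) :
    HasDerivAt (cosMode c s k) (cosModeDeriv c s k t) t := by
  have h : HasDerivAt (fun t => Real.pi * k / s * (t - c)) (Real.pi * k / s) t := by
    simpa using ((hasDerivAt_id t).sub_const c).const_mul (Real.pi * k / s)
  exact (h.cos.const_mul √(absMult k / s)).congr_deriv (by unfold cosModeDeriv; ring)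

theorem hasDerivAt_cosModeDeriv (c s : ℝ) (k : ℕ) (t : ℝ) :
    HasDerivAt (cosModeDeriv c s k) (-(Real.pi * k / s) ^ 2 * cosMode c s k t) t := by
  have h : HasDerivAt (fun t => Real.pi * k / s * (t - c)) (Real.pi * k / s) t := by
    simpa using ((hasDerivAt_id t).sub_const c).const_mul (Real.pi * k / s)
  exact ((h.sin.const_mul (-(Real.pi * k / s))).const_mul √(absMult k / s)).congr_deriv
    (by unfold cosMode; ring)

theorem cosModeDeriv_left (c s : ℝ) (k : ℕ) : cosModeDeriv c s k c = 0 := by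
  simp [cosModeDeriv]

theorem cosModeDeriv_right (c : ℝ) {s : ℝ} (hs : 0 < s) (k : ℕ) :
    cosModeDeriv c s k (c + s) = 0 := by
  have : Real.pi * k / s * (c + s - c) = k * Real.pi := by field_simp; ring
  rw [cosModeDeriv, this, Real.sin_nat_mul_pi, mul_zero, mul_zero]

theorem contDiff_cosMode (c s : ℝ) (k : ℕ) : ContDiff ℝ 2 (cosMode c s k) := by
  unfold cosMode; fun_prop

theorem cosMode_sq_le (c : ℝ) {s : ℝ} (hs : 0 < s) (k : ℕ) (t : ℝ) :
    cosMode c s k t ^ 2 ≤ absMult k / s := by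
  have h := div_nonneg (absMult_nonneg k) hs.le
  rw [cosMode, mul_pow, Real.sq_sqrt h]
  exact mul_le_of_le_one_right h (Real.cos_sq_le_one _)

theorem integral_cos_int_mul (c : ℝ) {s : ℝ} (hs : 0 < s) (n : ℤ) :
    ∫ t in c..(c + s), Real.cos (Real.pi * n / s * (t - c)) = if n = 0 then s else 0 := by
  split_ifs with hn
  · simp [hn]
  · have hn' : (n : ℝ) ≠ 0 := by exact_mod_cast hn
    have hne : Real.pi * n / s ≠ 0 := by
      have := Real.pi_ne_zero
      positivity
    have hd (t : ℝ) : HasDerivAt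
        (fun t => (Real.pi * n / s)⁻¹ * Real.sin (Real.pi * n / s * (t - c)))
        (Real.cos (Real.pi * n / s * (t - c))) t := by
      have h : HasDerivAt (fun t => Real.pi * n / s * (t - c)) (Real.pi * n / s) t := by
        simpa using ((hasDerivAt_id t).sub_const c).const_mul (Real.pi * n / s)
      refine (h.sin.const_mul (Real.pi * n / s)⁻¹).congr_deriv ?_
      rw [mul_comm (Real.cos _), inv_mul_cancel_left₀ hne]
    rw [intervalIntegral.integral_eq_sub_of_hasDerivAt (fun t _ => hd t)
      (Continuous.intervalIntegrable (by fun_prop) _ _)]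
    have : Real.pi * n / s * (c + s - c) = n * Real.pi := by field_simp; ring
    rw [this, Real.sin_int_mul_pi, sub_self, mul_zero, mul_zero, Real.sin_zero, mul_zero, sub_self]

theorem integral_cosMode_mul_cosMode (c : ℝ) {s : ℝ} (hs : 0 < s) (k l : ℕ) :
    ∫ t in Set.Icc c (c + s), cosMode c s k t * cosMode c s l t = if k = l then 1 else 0 := by
  rw [integral_Icc_eq_integral_Ioc, ← intervalIntegral.integral_of_le (by linarith)]
  have e (t : ℝ) : cosMode c s k t * cosMode c s l t
      = √(absMult k / s) * √(absMult l / s) / 2 *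
        (Real.cos (Real.pi * ((k - l : ℤ) : ℝ) / s * (t - c))
          + Real.cos (Real.pi * ((k + l : ℤ) : ℝ) / s * (t - c))) := by
    have h1 : Real.pi * ((k - l : ℤ) : ℝ) / s * (t - c)
      = Real.pi * k / s * (t - c) - Real.pi * l / s * (t - c) := by push_cast; ring
    have h2 : Real.pi * ((k + l : ℤ) : ℝ) / s * (t - c)
      = Real.pi * k / s * (t - c) + Real.pi * l / s * (t - c) := by push_cast; ring
    rw [h1, h2, Real.cos_sub, Real.cos_add, cosMode, cosMode]
    ring
  simp_rw [e]
  rw [intervalIntegral.integral_const_mul, intervalIntegral.integral_add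
    (Continuous.intervalIntegrable (by fun_prop) _ _)
    (Continuous.intervalIntegrable (by fun_prop) _ _),
    integral_cos_int_mul c hs, integral_cos_int_mul c hs]
  by_cases hkl : k = l
  · subst hkl
    rw [Real.mul_self_sqrt (div_nonneg (absMult_nonneg k) hs.le)]
    by_cases hk : k = 0
    · subst hk
      simp [absMult]
      field_simp
      ring
    · have : ¬ ((k : ℤ) + k = 0) := by omega
      simp [absMult, hk, this]
      field_simp
  · have h1 : ¬ ((k : ℤ) - l = 0) := by omega
    have h2 : ¬ ((k : ℤ) + l = 0) := by omega
    rw [if_neg hkl, if_neg h1, if_neg h2]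
    ring

/-- The normalized Neumann eigenfunctions on the cube `∏ i, [c i, c i + s]`. -/
noncomputable def neumannMode {d : ℕ} (c : Fin d → ℝ) (s : ℝ) (k : Fin d → ℕ) (x : Fin d → ℝ) : ℝ :=
  ∏ i, cosMode (c i) s (k i) (x i)

/-- The Neumann eigenvalues of the Laplacian on a cube of side `s`. -/
noncomputable def neumannEigenvalue {d : ℕ} (s : ℝ) (k : Fin d → ℕ) : ℝ :=
  ∑ i, (Real.pi * k i / s) ^ 2

/-- The cube with corner `c` and side `s`. -/
def cube {d : ℕ} (c : Fin d → ℝ) (s : ℝ) : Set (Fin d → ℝ) := Set.Icc c fun i => c i + s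

theorem isCompact_cube {d : ℕ} (c : Fin d → ℝ) (s : ℝ) : IsCompact (cube c s) := isCompact_Icc

theorem measurableSet_cube {d : ℕ} (c : Fin d → ℝ) (s : ℝ) : MeasurableSet (cube c s) :=
  measurableSet_Icc

theorem neumannEigenvalue_nonneg {d : ℕ} (s : ℝ) (k : Fin d → ℕ) : 0 ≤ neumannEigenvalue s k :=
  Finset.sum_nonneg fun _ _ => sq_nonneg _

theorem contDiff_neumannMode {d : ℕ} (c : Fin d → ℝ) (s : ℝ) (k : Fin d → ℕ) :
    ContDiff ℝ 2 (neumannMode c s k) :=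
  contDiff_prod fun i _ => (contDiff_cosMode (c i) s (k i)).comp (contDiff_apply ℝ ℝ i)

theorem continuous_neumannMode {d : ℕ} (c : Fin d → ℝ) (s : ℝ) (k : Fin d → ℕ) :
    Continuous (neumannMode c s k) := (contDiff_neumannMode c s k).continuous

theorem neumannMode_sq_le {d : ℕ} (c : Fin d → ℝ) {s : ℝ} (hs : 0 < s) (k : Fin d → ℕ)
    (x : Fin d → ℝ) : neumannMode c s k x ^ 2 ≤ (∏ i, absMult (k i)) / s ^ d := by
  rw [neumannMode, ← Finset.prod_pow]
  calc _ ≤ ∏ i, absMult (k i) / s :=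
        Finset.prod_le_prod (fun _ _ => sq_nonneg _) fun i _ => cosMode_sq_le (c i) hs (k i) (x i)
    _ = _ := by simp [Finset.prod_div_distrib]

theorem integral_neumannMode_mul_neumannMode {d : ℕ} (c : Fin d → ℝ) {s : ℝ} (hs : 0 < s)
    (k l : Fin d → ℕ) :
    ∫ x in cube c s, neumannMode c s k x * neumannMode c s l x = if k = l then 1 else 0 := by
  have hc : cube c s = Set.univ.pi fun i => Set.Icc (c i) (c i + s) := by
    rw [cube, Set.pi_univ_Icc]
  simp_rw [neumannMode, ← Finset.prod_mul_distrib]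
  rw [hc, volume_pi, Measure.restrict_pi_pi, integral_fintype_prod_eq_prod
    (fun i t => cosMode (c i) s (k i) t * cosMode (c i) s (l i) t)]
  simp_rw [integral_cosMode_mul_cosMode _ hs]
  split_ifs with h
  · simp [h]
  · obtain ⟨i, hi⟩ := Function.ne_iff.1 h
    exact Finset.prod_eq_zero (Finset.mem_univ i) (if_neg hi)

theorem fderiv_single_of_update {d : ℕ} {G : (Fin d → ℝ) → ℝ} {x : Fin d → ℝ} {i : Fin d} {g' : ℝ}
    (hG : DifferentiableAt ℝ G x)
    (h : HasDerivAt (fun t => G (Function.update x i t)) g' (x i)) :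
    fderiv ℝ G x (Pi.single i 1) = g' := by
  have hx : Function.update x i (x i) = x := Function.update_eq_self i x
  have h1 : HasFDerivAt G (fderiv ℝ G x) (Function.update x i (x i)) := by
    rw [hx]; exact hG.hasFDerivAt
  exact (h1.comp_hasDerivAt (x i) (hasDerivAt_update x i (x i))).unique h

theorem neumannMode_update {d : ℕ} (c : Fin d → ℝ) (s : ℝ) (k : Fin d → ℕ) (x : Fin d → ℝ)
    (i : Fin d) (t : ℝ) : neumannMode c s k (Function.update x i t)
      = cosMode (c i) s (k i) t * ∏ j ∈ Finset.univ.erase i, cosMode (c j) s (k j) (x j) := by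
  rw [neumannMode, ← Finset.mul_prod_erase _ _ (Finset.mem_univ i), Function.update_self]
  congr 1
  refine Finset.prod_congr rfl fun j hj => ?_
  rw [Function.update_of_ne (Finset.ne_of_mem_erase hj)]

theorem fderiv_neumannMode_single {d : ℕ} (c : Fin d → ℝ) (s : ℝ) (k : Fin d → ℕ) (x : Fin d → ℝ)
    (i : Fin d) : fderiv ℝ (neumannMode c s k) x (Pi.single i 1)
      = cosModeDeriv (c i) s (k i) (x i)
        * ∏ j ∈ Finset.univ.erase i, cosMode (c j) s (k j) (x j) := by
  refine fderiv_single_of_update ((contDiff_neumannMode c s k).differentiable two_ne_zero x) ?_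
  simp_rw [neumannMode_update]
  exact (hasDerivAt_cosMode _ _ _ _).mul_const _

theorem contDiff_fderiv_single {d : ℕ} {f : (Fin d → ℝ) → ℝ} {n : WithTop ℕ∞}
    (hf : ContDiff ℝ (n + 1) f) (i : Fin d) :
    ContDiff ℝ n fun x => fderiv ℝ f x (Pi.single i 1) :=
  (hf.fderiv_right le_rfl).clm_apply contDiff_const

theorem fderiv_fderiv_neumannMode_single {d : ℕ} (c : Fin d → ℝ) (s : ℝ) (k : Fin d → ℕ)
    (x : Fin d → ℝ) (i : Fin d) :
    fderiv ℝ (fun y => fderiv ℝ (neumannMode c s k) y (Pi.single i 1)) x (Pi.single i 1)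
      = -(Real.pi * k i / s) ^ 2 * neumannMode c s k x := by
  refine fderiv_single_of_update ((contDiff_fderiv_single (n := 1)
    (contDiff_neumannMode c s k) i).differentiable one_ne_zero x) ?_
  have h := neumannMode_update c s k x i (x i)
  rw [Function.update_eq_self] at h
  have e (t : ℝ) : fderiv ℝ (neumannMode c s k) (Function.update x i t) (Pi.single i 1)
      = cosModeDeriv (c i) s (k i) t * ∏ j ∈ Finset.univ.erase i, cosMode (c j) s (k j) (x j) := by
    rw [fderiv_neumannMode_single, Function.update_self]
    congr 1
    refine Finset.prod_congr rfl fun j hj => ?_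
    rw [Function.update_of_ne (Finset.ne_of_mem_erase hj)]
  simp_rw [e]
  exact ((hasDerivAt_cosModeDeriv _ _ _ _).mul_const _).congr_deriv (by rw [h]; ring)

/-- Green's identity for a `C¹` function and a Neumann eigenfunction. -/
theorem integral_grad_mul_grad_neumannMode {d : ℕ} (hd : 1 ≤ d) (c : Fin d → ℝ) {s : ℝ}
    (hs : 0 < s) (k : Fin d → ℕ) {f : (Fin d → ℝ) → ℝ} (hf : ContDiff ℝ 1 f) :
    ∫ x in cube c s, ∑ i, fderiv ℝ f x (Pi.single i 1)
        * fderiv ℝ (neumannMode c s k) x (Pi.single i 1)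
      = neumannEigenvalue s k * ∫ x in cube c s, f x * neumannMode c s k x := by
  obtain ⟨n, rfl⟩ := Nat.exists_eq_add_of_le' hd
  set φ := neumannMode c s k with hφ
  have hφ2 : ContDiff ℝ 2 φ := contDiff_neumannMode c s k
  have hD (i : Fin (n + 1)) : ContDiff ℝ 1 fun x => fderiv ℝ φ x (Pi.single i 1) :=
    contDiff_fderiv_single (n := 1) hφ2 i
  have hdf (i : Fin (n + 1)) : Continuous fun x => fderiv ℝ f x (Pi.single i 1) :=
    (contDiff_fderiv_single (n := 0) (by simpa using hf) i).continuous
  have hdiv (x : Fin (n + 1) → ℝ) : ∑ i, fderiv ℝ (fun y => f y * fderiv ℝ φ y (Pi.single i 1)) x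
      (Pi.single i 1) = ∑ i, fderiv ℝ f x (Pi.single i 1) * fderiv ℝ φ x (Pi.single i 1)
        - neumannEigenvalue s k * (f x * φ x) := by
    rw [neumannEigenvalue, Finset.sum_mul, ← Finset.sum_sub_distrib]
    refine Finset.sum_congr rfl fun i _ => ?_
    rw [fderiv_fun_mul (hf.differentiable one_ne_zero x) ((hD i).differentiable one_ne_zero x)]
    simp only [add_apply, smul_apply, smul_eq_mul]
    rw [fderiv_fderiv_neumannMode_single]
    ring
  have hcont1 : Continuous fun x => ∑ i, fderiv ℝ f x (Pi.single i 1)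
      * fderiv ℝ φ x (Pi.single i 1) :=
    continuous_finsetSum _ fun i _ => (hdf i).mul (hD i).continuous
  have hcont2 : Continuous fun x => neumannEigenvalue s k * (f x * φ x) :=
    continuous_const.mul (hf.continuous.mul hφ2.continuous)
  have key := integral_divergence_of_hasFDerivAt_off_countable' c (fun i => c i + s)
    (fun i => by simpa using hs.le) (fun i x => f x * fderiv ℝ φ x (Pi.single i 1))
    (fun i x => fderiv ℝ (fun y => f y * fderiv ℝ φ y (Pi.single i 1)) x) ∅ Set.countable_empty
    (fun i => (hf.continuous.mul (hD i).continuous).continuousOn)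
    (fun x _ i => ((hf.mul (hD i)).differentiable one_ne_zero x).hasFDerivAt)
    (by simp_rw [hdiv]; exact (hcont1.sub hcont2).continuousOn.integrableOn_compact isCompact_Icc)
  have hface (i : Fin (n + 1)) (y : Fin n → ℝ) :
      fderiv ℝ φ (i.insertNth (c i + s) y) (Pi.single i 1) = 0 ∧
      fderiv ℝ φ (i.insertNth (c i) y) (Pi.single i 1) = 0 := by
    rw [hφ, fderiv_neumannMode_single, fderiv_neumannMode_single, Fin.insertNth_apply_same,
      Fin.insertNth_apply_same, cosModeDeriv_right _ hs, cosModeDeriv_left]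
    simp
  simp only [hdiv, (hface _ _).1, (hface _ _).2, mul_zero, integral_zero, sub_self,
    Finset.sum_const_zero] at key
  rw [integral_sub (hcont1.continuousOn.integrableOn_compact isCompact_Icc)
    (hcont2.continuousOn.integrableOn_compact isCompact_Icc), integral_const_mul] at key
  exact sub_eq_zero.1 key

/-- The Fourier coefficients with respect to the Neumann eigenfunctions. -/
noncomputable def neumannCoeff {d : ℕ} (c : Fin d → ℝ) (s : ℝ) (f : (Fin d → ℝ) → ℝ)
    (k : Fin d → ℕ) : ℝ := ∫ x in cube c s, f x * neumannMode c s k x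

theorem integrableOn_cube {d : ℕ} {c : Fin d → ℝ} {s : ℝ} {f : (Fin d → ℝ) → ℝ}
    (hf : Continuous f) : IntegrableOn f (cube c s) :=
  hf.continuousOn.integrableOn_compact (isCompact_cube c s)

theorem integral_mul_sum_neumannMode {d : ℕ} (c : Fin d → ℝ) (s : ℝ) {f : (Fin d → ℝ) → ℝ}
    (hf : Continuous f) (S : Finset (Fin d → ℕ)) (b : (Fin d → ℕ) → ℝ) :
    ∫ x in cube c s, f x * ∑ k ∈ S, b k * neumannMode c s k x
      = ∑ k ∈ S, b k * neumannCoeff c s f k := by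
  simp_rw [Finset.mul_sum, mul_left_comm (f _)]
  rw [integral_finsetSum]
  · simp_rw [integral_const_mul]
    rfl
  · exact fun k _ => integrableOn_cube
      (continuous_const.mul (hf.mul (continuous_neumannMode c s k)))

theorem continuous_sum_neumannMode {d : ℕ} (c : Fin d → ℝ) (s : ℝ) (S : Finset (Fin d → ℕ))
    (b : (Fin d → ℕ) → ℝ) : Continuous fun x => ∑ k ∈ S, b k * neumannMode c s k x :=
  continuous_finsetSum _ fun k _ => continuous_const.mul (continuous_neumannMode c s k)

theorem neumannCoeff_sum_neumannMode {d : ℕ} (c : Fin d → ℝ) {s : ℝ} (hs : 0 < s)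
    (S : Finset (Fin d → ℕ)) (b : (Fin d → ℕ) → ℝ) {k : Fin d → ℕ} (hk : k ∈ S) :
    neumannCoeff c s (fun x => ∑ l ∈ S, b l * neumannMode c s l x) k = b k := by
  have := integral_mul_sum_neumannMode c s (continuous_neumannMode c s k) S b
  simp_rw [neumannCoeff, mul_comm _ (neumannMode c s k _), this, neumannCoeff,
    integral_neumannMode_mul_neumannMode c hs]
  simp [hk]

theorem integral_sub_sum_neumannMode_sq {d : ℕ} (c : Fin d → ℝ) {s : ℝ} (hs : 0 < s)
    {f : (Fin d → ℝ) → ℝ} (hf : Continuous f) (S : Finset (Fin d → ℕ)) (b : (Fin d → ℕ) → ℝ) :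
    ∫ x in cube c s, (f x - ∑ k ∈ S, b k * neumannMode c s k x) ^ 2
      = (∫ x in cube c s, f x ^ 2) - 2 * ∑ k ∈ S, b k * neumannCoeff c s f k
        + ∑ k ∈ S, b k ^ 2 := by
  have hg := continuous_sum_neumannMode c s S b
  set g := fun x => ∑ k ∈ S, b k * neumannMode c s k x with hgdef
  have e (x : Fin d → ℝ) : (f x - g x) ^ 2 = f x ^ 2 - 2 * (f x * g x) + g x * g x := by ring
  change ∫ x in cube c s, (f x - g x) ^ 2 = _
  simp_rw [e]
  rw [integral_add (integrableOn_cube (by fun_prop)) (integrableOn_cube (by fun_prop)),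
    integral_sub (integrableOn_cube (by fun_prop)) (integrableOn_cube (by fun_prop)),
    integral_const_mul, integral_mul_sum_neumannMode c s hf S b,
    integral_mul_sum_neumannMode c s hg S b]
  congr 1
  refine Finset.sum_congr rfl fun k hk => ?_
  rw [neumannCoeff_sum_neumannMode c hs S b hk, sq]

/-- Bessel's identity. -/
theorem integral_sub_proj_sq {d : ℕ} (c : Fin d → ℝ) {s : ℝ} (hs : 0 < s)
    {f : (Fin d → ℝ) → ℝ} (hf : Continuous f) (S : Finset (Fin d → ℕ)) :
    ∫ x in cube c s, (f x - ∑ k ∈ S, neumannCoeff c s f k * neumannMode c s k x) ^ 2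
      = (∫ x in cube c s, f x ^ 2) - ∑ k ∈ S, neumannCoeff c s f k ^ 2 := by
  rw [integral_sub_sum_neumannMode_sq c hs hf]
  simp_rw [← sq]
  ring

theorem sum_neumannCoeff_sq_le {d : ℕ} (c : Fin d → ℝ) {s : ℝ} (hs : 0 < s)
    {f : (Fin d → ℝ) → ℝ} (hf : Continuous f) (S : Finset (Fin d → ℕ)) :
    ∑ k ∈ S, neumannCoeff c s f k ^ 2 ≤ ∫ x in cube c s, f x ^ 2 := by
  rw [← sub_nonneg, ← integral_sub_proj_sq c hs hf]
  exact integral_nonneg fun x => sq_nonneg _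

/-- Bessel's inequality for the gradient. -/
theorem sum_neumannEigenvalue_mul_sq_le {d : ℕ} (hd : 1 ≤ d) (c : Fin d → ℝ) {s : ℝ} (hs : 0 < s)
    {f : (Fin d → ℝ) → ℝ} (hf : ContDiff ℝ 1 f) (S : Finset (Fin d → ℕ)) :
    ∑ k ∈ S, neumannEigenvalue s k * neumannCoeff c s f k ^ 2
      ≤ ∫ x in cube c s, ∑ i, fderiv ℝ f x (Pi.single i 1) ^ 2 := by
  set a := neumannCoeff c s f with ha
  set g := fun x => ∑ k ∈ S, a k * neumannMode c s k x with hgdef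
  have hg : ContDiff ℝ 1 g := ContDiff.sum fun k _ =>
    contDiff_const.mul ((contDiff_neumannMode c s k).of_le one_le_two)
  have hcont {h : (Fin d → ℝ) → ℝ} (hh : ContDiff ℝ 1 h) (i : Fin d) :
      Continuous fun x => fderiv ℝ h x (Pi.single i 1) :=
    (contDiff_fderiv_single (n := 0) (by simpa using hh) i).continuous
  have hdg (x : Fin d → ℝ) (i : Fin d) : fderiv ℝ g x (Pi.single i 1)
      = ∑ k ∈ S, a k * fderiv ℝ (neumannMode c s k) x (Pi.single i 1) := by
    have hm (k : Fin d → ℕ) : DifferentiableAt ℝ (neumannMode c s k) x :=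
      (contDiff_neumannMode c s k).differentiable two_ne_zero x
    rw [hgdef, fderiv_fun_sum fun k _ => (hm k).const_mul (a k)]
    simp [fderiv_const_mul (hm _)]
  have hgreen {h : (Fin d → ℝ) → ℝ} (hh : ContDiff ℝ 1 h) :
      ∫ x in cube c s, ∑ i, fderiv ℝ h x (Pi.single i 1) * fderiv ℝ g x (Pi.single i 1)
        = ∑ k ∈ S, a k * (neumannEigenvalue s k * neumannCoeff c s h k) := by
    have e (x : Fin d → ℝ) :
        ∑ i, fderiv ℝ h x (Pi.single i 1) * fderiv ℝ g x (Pi.single i 1)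
        = ∑ k ∈ S, a k * ∑ i, fderiv ℝ h x (Pi.single i 1)
          * fderiv ℝ (neumannMode c s k) x (Pi.single i 1) := by
      simp_rw [hdg, Finset.mul_sum]
      rw [Finset.sum_comm]
      exact Finset.sum_congr rfl fun k _ => Finset.sum_congr rfl fun i _ => by ring
    simp_rw [e]
    rw [integral_finsetSum]
    · simp_rw [integral_const_mul, integral_grad_mul_grad_neumannMode hd c hs _ hh]
      rfl
    · exact fun k _ => integrableOn_cube (continuous_const.mul
        (continuous_finsetSum _ fun i _ => (hcont hh i).mul
          (hcont ((contDiff_neumannMode c s k).of_le one_le_two) i)))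
  have hnn : 0 ≤ ∫ x in cube c s,
      ∑ i, (fderiv ℝ f x (Pi.single i 1) - fderiv ℝ g x (Pi.single i 1)) ^ 2 :=
    integral_nonneg fun x => Finset.sum_nonneg fun i _ => sq_nonneg _
  have e (x : Fin d → ℝ) :
      ∑ i, (fderiv ℝ f x (Pi.single i 1) - fderiv ℝ g x (Pi.single i 1)) ^ 2
      = ∑ i, fderiv ℝ f x (Pi.single i 1) ^ 2
        - 2 * ∑ i, fderiv ℝ f x (Pi.single i 1) * fderiv ℝ g x (Pi.single i 1)
        + ∑ i, fderiv ℝ g x (Pi.single i 1) * fderiv ℝ g x (Pi.single i 1) := by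
    rw [Finset.mul_sum, ← Finset.sum_sub_distrib, ← Finset.sum_add_distrib]
    exact Finset.sum_congr rfl fun i _ => by ring
  have hcf := hcont hf
  have hcg := hcont hg
  simp_rw [e] at hnn
  rw [integral_add (integrableOn_cube (by fun_prop)) (integrableOn_cube (by fun_prop)),
    integral_sub (integrableOn_cube (by fun_prop)) (integrableOn_cube (by fun_prop)),
    integral_const_mul, hgreen hf, hgreen hg] at hnn
  have h1 : ∑ k ∈ S, a k * (neumannEigenvalue s k * neumannCoeff c s f k)
      = ∑ k ∈ S, neumannEigenvalue s k * a k ^ 2 :=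
    Finset.sum_congr rfl fun k _ => by rw [← ha]; ring
  have h2 : ∑ k ∈ S, a k * (neumannEigenvalue s k * neumannCoeff c s g k)
      = ∑ k ∈ S, neumannEigenvalue s k * a k ^ 2 :=
    Finset.sum_congr rfl fun k hk => by rw [neumannCoeff_sum_neumannMode c hs S a hk]; ring
  rw [h1, h2] at hnn
  linarith

/-- Unnormalized products of cosines as continuous functions on the cube. -/
noncomputable def cosProd {d : ℕ} (c : Fin d → ℝ) (s : ℝ) (k : Fin d → ℕ) : C(cube c s, ℝ) :=
  ⟨fun x => ∏ i, Real.cos (Real.pi * k i / s * (x.1 i - c i)),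
    continuous_finsetProd _ fun i _ => Real.continuous_cos.comp (continuous_const.mul
      (((continuous_apply i).comp continuous_subtype_val).sub continuous_const))⟩

theorem cosProd_apply {d : ℕ} (c : Fin d → ℝ) (s : ℝ) (k : Fin d → ℕ) (x : cube c s) :
    cosProd c s k x = ∏ i, Real.cos (Real.pi * k i / s * (x.1 i - c i)) := rfl

theorem cosProd_single_apply {d : ℕ} (c : Fin d → ℝ) (s : ℝ) (i : Fin d) (x : cube c s) :
    cosProd c s (Pi.single i 1) x = Real.cos (Real.pi / s * (x.1 i - c i)) := by
  rw [cosProd_apply, Finset.prod_eq_single i]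
  · simp
  · intro j _ hj
    simp [Pi.single_eq_of_ne hj]
  · simp

theorem cosProd_single_mul_mem_span {d : ℕ} (c : Fin d → ℝ) (s : ℝ) (i : Fin d) (k : Fin d → ℕ) :
    cosProd c s (Pi.single i 1) * cosProd c s k
      ∈ Submodule.span ℝ (Set.range (cosProd c s)) := by
  have hmem (l : Fin d → ℕ) : cosProd c s l ∈ Submodule.span ℝ (Set.range (cosProd c s)) :=
    Submodule.subset_span ⟨l, rfl⟩
  have hupd (m : ℕ) (x : cube c s) : cosProd c s (Function.update k i m) x
      = Real.cos (Real.pi * m / s * (x.1 i - c i))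
        * ∏ j ∈ Finset.univ.erase i, Real.cos (Real.pi * k j / s * (x.1 j - c j)) := by
    rw [cosProd_apply, ← Finset.mul_prod_erase _ _ (Finset.mem_univ i), Function.update_self]
    congr 1
    refine Finset.prod_congr rfl fun j hj => ?_
    rw [Function.update_of_ne (Finset.ne_of_mem_erase hj)]
  rcases Nat.eq_zero_or_pos (k i) with h0 | hpos
  · have : cosProd c s (Pi.single i 1) * cosProd c s k = cosProd c s (Function.update k i 1) := by
      ext x
      have hk := hupd (k i) x
      rw [Function.update_eq_self, h0] at hk
      rw [ContinuousMap.mul_apply, cosProd_single_apply, hk, hupd]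
      simp
    rw [this]
    exact hmem _
  · have : cosProd c s (Pi.single i 1) * cosProd c s k
        = (1 / 2 : ℝ) • (cosProd c s (Function.update k i (k i + 1))
          + cosProd c s (Function.update k i (k i - 1))) := by
      ext x
      have hk := hupd (k i) x
      rw [Function.update_eq_self] at hk
      rw [ContinuousMap.mul_apply, cosProd_single_apply, hk, ContinuousMap.smul_apply, ContinuousMap.add_apply,
        hupd, hupd, Nat.cast_add, Nat.cast_sub hpos]
      have h1 : Real.pi * ((k i : ℝ) + (1 : ℕ)) / s * (x.1 i - c i)
          = Real.pi * k i / s * (x.1 i - c i) + Real.pi / s * (x.1 i - c i) := by push_cast; ring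
      have h2 : Real.pi * ((k i : ℝ) - (1 : ℕ)) / s * (x.1 i - c i)
          = Real.pi * k i / s * (x.1 i - c i) - Real.pi / s * (x.1 i - c i) := by push_cast; ring
      rw [h1, h2, Real.cos_add, Real.cos_sub, smul_eq_mul]
      ring
    rw [this]
    exact Submodule.smul_mem _ _ (Submodule.add_mem _ (hmem _) (hmem _))

theorem adjoin_cosProd_le_span {d : ℕ} (c : Fin d → ℝ) (s : ℝ) (f : C(cube c s, ℝ))
    (hf : f ∈ Algebra.adjoin ℝ (Set.range fun i : Fin d => cosProd c s (Pi.single i 1))) :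
    f ∈ Submodule.span ℝ (Set.range (cosProd c s)) := by
  have key : ∀ v ∈ Submodule.span ℝ (Set.range (cosProd c s)),
      f * v ∈ Submodule.span ℝ (Set.range (cosProd c s)) := by
    induction hf using Algebra.adjoin_induction with
    | mem x hx =>
      obtain ⟨i, rfl⟩ := hx
      intro v hv
      induction hv using Submodule.span_induction with
      | mem y hy =>
        obtain ⟨k, rfl⟩ := hy
        exact cosProd_single_mul_mem_span c s i k
      | zero => simp
      | add y z _ _ hy hz => rw [mul_add]; exact Submodule.add_mem _ hy hz
      | smul r y _ hy => rw [mul_smul_comm]; exact Submodule.smul_mem _ _ hy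
    | algebraMap r =>
      intro v hv
      rw [← Algebra.smul_def]
      exact Submodule.smul_mem _ _ hv
    | add x y _ _ hx hy => intro v hv; rw [add_mul]; exact Submodule.add_mem _ (hx v hv) (hy v hv)
    | mul x y _ _ hx hy => intro v hv; rw [mul_assoc]; exact hx _ (hy v hv)
  have hone : cosProd c s 0 = 1 := by
    ext x
    simp [cosProd]
  have := key 1 (hone ▸ Submodule.subset_span ⟨0, rfl⟩)
  rwa [mul_one] at this

/-- Uniform approximation on the cube by linear combinations of Neumann eigenfunctions. -/
theorem exists_sum_neumannMode_near {d : ℕ} (c : Fin d → ℝ) {s : ℝ} (hs : 0 < s)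
    {f : (Fin d → ℝ) → ℝ} (hf : Continuous f) {ε : ℝ} (hε : 0 < ε) :
    ∃ (S : Finset (Fin d → ℕ)) (b : (Fin d → ℕ) → ℝ), ∀ x ∈ cube c s,
      |f x - ∑ k ∈ S, b k * neumannMode c s k x| < ε := by
  have : CompactSpace (cube c s) := isCompact_iff_compactSpace.1 (isCompact_cube c s)
  set A := Algebra.adjoin ℝ (Set.range fun i : Fin d => cosProd c s (Pi.single i 1)) with hA
  have hsep : A.SeparatesPoints := by
    intro x y hxy
    obtain ⟨i, hi⟩ : ∃ i, x.1 i ≠ y.1 i := by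
      by_contra! h
      exact hxy (Subtype.ext (funext h))
    refine ⟨_, ⟨cosProd c s (Pi.single i 1), Algebra.subset_adjoin ⟨i, rfl⟩, rfl⟩, ?_⟩
    have hmem (x : cube c s) : Real.pi / s * (x.1 i - c i) ∈ Set.Icc 0 Real.pi := by
      have h1 := x.2.1 i
      have h2 := x.2.2 i
      have hp := Real.pi_pos
      refine ⟨mul_nonneg (by positivity) (sub_nonneg.2 h1), ?_⟩
      rw [div_mul_eq_mul_div, div_le_iff₀ hs]
      exact mul_le_mul_of_nonneg_left (by simpa using sub_le_iff_le_add'.2 h2) hp.le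
    change cosProd c s (Pi.single i 1) x ≠ cosProd c s (Pi.single i 1) y
    rw [cosProd_single_apply, cosProd_single_apply]
    intro h
    have h' := Real.injOn_cos (hmem x) (hmem y) h
    have hne : Real.pi / s ≠ 0 := by
      have := Real.pi_pos
      positivity
    exact hi (sub_left_injective (mul_left_cancel₀ hne h'))
  have htop := ContinuousMap.subalgebra_topologicalClosure_eq_top_of_separatesPoints A hsep
  set F : C(cube c s, ℝ) := ⟨fun x => f x.1, by fun_prop⟩ with hF
  have hFmem : F ∈ closure (A : Set C(cube c s, ℝ)) := by
    rw [← Subalgebra.topologicalClosure_coe, htop]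
    trivial
  obtain ⟨G, hGA, hG⟩ := Metric.mem_closure_iff.1 hFmem ε hε
  obtain ⟨b, hb⟩ := (Finsupp.mem_span_range_iff_exists_finsupp).1
    (adjoin_cosProd_le_span c s G hGA)
  refine ⟨b.support, fun k => b k * (∏ i, √(absMult (k i) / s))⁻¹, fun x hx => ?_⟩
  have hdist := (ContinuousMap.dist_apply_le_dist (f := F) (g := G) ⟨x, hx⟩).trans_lt hG
  rw [Real.dist_eq] at hdist
  have e : ∑ k ∈ b.support, b k * (∏ i, √(absMult (k i) / s))⁻¹ * neumannMode c s k x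
      = G ⟨x, hx⟩ := ?_
  · rwa [e]
  rw [← hb, Finsupp.sum, ContinuousMap.sum_apply]
  refine Finset.sum_congr rfl fun k _ => ?_
  have hne : ∏ i, √(absMult (k i) / s) ≠ 0 := by
    refine Finset.prod_ne_zero_iff.2 fun i _ => (Real.sqrt_pos.2 (div_pos ?_ hs)).ne'
    unfold absMult
    split_ifs <;> norm_num
  simp only [neumannMode, cosMode, Finset.prod_mul_distrib]
  rw [mul_assoc, inv_mul_cancel_left₀ hne]
  rfl

/-- Parseval's identity. -/
theorem hasSum_neumannCoeff_sq {d : ℕ} (c : Fin d → ℝ) {s : ℝ} (hs : 0 < s)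
    {f : (Fin d → ℝ) → ℝ} (hf : Continuous f) :
    HasSum (fun k => neumannCoeff c s f k ^ 2) (∫ x in cube c s, f x ^ 2) := by
  have hsum : Summable fun k => neumannCoeff c s f k ^ 2 :=
    summable_of_sum_le (fun _ => sq_nonneg _) (sum_neumannCoeff_sq_le c hs hf)
  have hle : ∑' k, neumannCoeff c s f k ^ 2 ≤ ∫ x in cube c s, f x ^ 2 :=
    hsum.tsum_le_of_sum_le (sum_neumannCoeff_sq_le c hs hf)
  have hge (ε : ℝ) (hε : 0 < ε) : ∫ x in cube c s, f x ^ 2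
      ≤ ∑' k, neumannCoeff c s f k ^ 2 + ε ^ 2 * volume.real (cube c s) := by
    obtain ⟨S, b, hSb⟩ := exists_sum_neumannMode_near c hs hf hε
    have h1 : ∫ x in cube c s, (f x - ∑ k ∈ S, b k * neumannMode c s k x) ^ 2
        ≤ ε ^ 2 * volume.real (cube c s) := by
      rw [mul_comm, ← smul_eq_mul, ← setIntegral_const]
      have hg := continuous_sum_neumannMode c s S b
      refine setIntegral_mono_on (integrableOn_cube (by fun_prop))
        (integrableOn_cube continuous_const) (measurableSet_cube c s) fun x hx => ?_
      rw [← sq_abs]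
      exact pow_le_pow_left₀ (abs_nonneg _) (hSb x hx).le 2
    rw [integral_sub_sum_neumannMode_sq c hs hf] at h1
    have h2 : 0 ≤ ∑ k ∈ S, (b k - neumannCoeff c s f k) ^ 2 :=
      Finset.sum_nonneg fun _ _ => sq_nonneg _
    have h3 : ∑ k ∈ S, (b k - neumannCoeff c s f k) ^ 2 = ∑ k ∈ S, b k ^ 2
        - 2 * ∑ k ∈ S, b k * neumannCoeff c s f k + ∑ k ∈ S, neumannCoeff c s f k ^ 2 := by
      rw [Finset.mul_sum, ← Finset.sum_sub_distrib, ← Finset.sum_add_distrib]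
      exact Finset.sum_congr rfl fun k _ => by ring
    have h4 := hsum.sum_le_tsum S fun _ _ => sq_nonneg _
    linarith
  have hge' : ∫ x in cube c s, f x ^ 2 ≤ ∑' k, neumannCoeff c s f k ^ 2 := by
    have hlim : Filter.Tendsto (fun ε : ℝ => ∑' k, neumannCoeff c s f k ^ 2
        + ε ^ 2 * volume.real (cube c s)) (nhdsWithin 0 (Set.Ioi 0))
        (nhds (∑' k, neumannCoeff c s f k ^ 2 + 0 ^ 2 * volume.real (cube c s))) :=
      (Continuous.tendsto (by fun_prop) 0).mono_left nhdsWithin_le_nhds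
    have := ge_of_tendsto hlim (Filter.eventually_of_mem self_mem_nhdsWithin hge)
    simpa using this
  rw [le_antisymm hge' hle]
  exact hsum.hasSum

/-- Pointwise bound for the low-energy part of a function. -/
theorem abs_proj_le {d : ℕ} (hd : 1 ≤ d) (c : Fin d → ℝ) {s : ℝ} (hs : 0 < s)
    {f : (Fin d → ℝ) → ℝ} (hf : Continuous f) {E : ℝ} (hE : 0 ≤ E) (S : Finset (Fin d → ℕ))
    (hS : ∀ k ∈ S, neumannEigenvalue s k ≤ E) (h0 : 0 ∈ S) (x : Fin d → ℝ) :
    |∑ k ∈ S, neumannCoeff c s f k * neumannMode c s k x|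
      ≤ (√(1 / s ^ d) + √(d * (2 * √E / Real.pi) ^ d)) * √(∫ x in cube c s, f x ^ 2) := by
  have hp := Real.pi_pos
  have hsplit (T : Finset (Fin d → ℕ)) (w : ℝ) (hw : (∑ k ∈ T, ∏ i, absMult (k i)) / s ^ d ≤ w) :
      |∑ k ∈ T, neumannCoeff c s f k * neumannMode c s k x|
        ≤ √w * √(∫ x in cube c s, f x ^ 2) := by
    have hm : ∑ k ∈ T, neumannMode c s k x ^ 2 ≤ w := by
      refine le_trans ?_ hw
      rw [Finset.sum_div]
      exact Finset.sum_le_sum fun k _ => neumannMode_sq_le c hs k x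
    have hw0 : 0 ≤ w := (Finset.sum_nonneg fun _ _ => sq_nonneg _).trans hm
    rw [← Real.sqrt_mul hw0]
    refine Real.abs_le_sqrt ((Finset.sum_mul_sq_le_sq_mul_sq T _ _).trans ?_)
    rw [mul_comm]
    exact mul_le_mul hm (sum_neumannCoeff_sq_le c hs hf T)
      (Finset.sum_nonneg fun _ _ => sq_nonneg _) hw0
  rw [← Finset.add_sum_erase S _ h0, add_mul]
  refine (abs_add_le _ _).trans (add_le_add ?_ (hsplit _ _ ?_))
  · simpa using hsplit {0} (1 / s ^ d) (by simp [absMult])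
  · have := sum_prod_absMult_nonzero_le hd (R := s * √E / Real.pi) (by positivity) (S.erase 0) (by
      intro k hk
      have hk' := hS k (Finset.mem_of_mem_erase hk)
      have e : ∑ i, (k i : ℝ) ^ 2 = (s / Real.pi) ^ 2 * neumannEigenvalue s k := by
        rw [neumannEigenvalue, Finset.mul_sum]
        refine Finset.sum_congr rfl fun i _ => ?_
        field_simp
      have e' : (s * √E / Real.pi) ^ 2 = (s / Real.pi) ^ 2 * E := by
        rw [div_pow, mul_pow, Real.sq_sqrt hE]
        ring
      rw [e, e']
      gcongr) (Finset.notMem_erase 0 S)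
    rw [div_le_iff₀ (by positivity)]
    refine this.trans (le_of_eq ?_)
    rw [mul_assoc, ← mul_pow]
    congr 2
    field_simp

theorem finite_neumannEigenvalue_le (d : ℕ) {s : ℝ} (hs : 0 < s) (E : ℝ) :
    {k : Fin d → ℕ | neumannEigenvalue s k ≤ E}.Finite := by
  have hp := Real.pi_pos
  refine (Set.Finite.pi fun _ : Fin d => Set.finite_Iic ⌊(s / Real.pi) ^ 2 * E⌋₊).subset ?_
  intro k hk i _
  refine Nat.le_floor ?_
  have h1 : (Real.pi * k i / s) ^ 2 ≤ E := (Finset.single_le_sum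
    (f := fun i => (Real.pi * k i / s) ^ 2) (fun i _ => sq_nonneg _) (Finset.mem_univ i)).trans hk
  have h2 : (k i : ℝ) ≤ (k i : ℝ) ^ 2 := by exact_mod_cast Nat.le_self_pow two_ne_zero (k i)
  calc (k i : ℝ) ≤ (k i : ℝ) ^ 2 := h2
    _ = (s / Real.pi) ^ 2 * (Real.pi * k i / s) ^ 2 := by field_simp
    _ ≤ _ := by gcongr

/-- The indices of the Neumann eigenvalues up to the energy `E`. -/
noncomputable def lowModes (d : ℕ) {s : ℝ} (hs : 0 < s) (E : ℝ) : Finset (Fin d → ℕ) :=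
  (finite_neumannEigenvalue_le d hs E).toFinset

theorem mem_lowModes {d : ℕ} {s : ℝ} (hs : 0 < s) {E : ℝ} {k : Fin d → ℕ} :
    k ∈ lowModes d hs E ↔ neumannEigenvalue s k ≤ E := by
  simp [lowModes]

/-- The part of `f` with energies above `E`. -/
noncomputable def highPart {d : ℕ} (c : Fin d → ℝ) {s : ℝ} (hs : 0 < s) (E : ℝ)
    (f : (Fin d → ℝ) → ℝ) (x : Fin d → ℝ) : ℝ :=
  f x - ∑ k ∈ lowModes d hs E, neumannCoeff c s f k * neumannMode c s k x

theorem continuous_highPart {d : ℕ} (c : Fin d → ℝ) {s : ℝ} (hs : 0 < s) (E : ℝ)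
    {f : (Fin d → ℝ) → ℝ} (hf : Continuous f) : Continuous (highPart c hs E f) :=
  hf.sub (continuous_sum_neumannMode c s _ _)

theorem ofReal_setIntegral_cube {d : ℕ} {c : Fin d → ℝ} {s : ℝ} {f : (Fin d → ℝ) → ℝ}
    (hf : Continuous f) (h0 : ∀ x, 0 ≤ f x) :
    ENNReal.ofReal (∫ x in cube c s, f x) = ∫⁻ x in cube c s, ENNReal.ofReal (f x) :=
  ofReal_integral_eq_lintegral_ofReal (integrableOn_cube hf) (Filter.Eventually.of_forall h0)

theorem lintegral_highPart_sq {d : ℕ} (c : Fin d → ℝ) {s : ℝ} (hs : 0 < s) (E : ℝ)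
    {f : (Fin d → ℝ) → ℝ} (hf : Continuous f) :
    ∫⁻ x in cube c s, ENNReal.ofReal (highPart c hs E f x ^ 2)
      = ∑' k, if E < neumannEigenvalue s k then ENNReal.ofReal (neumannCoeff c s f k ^ 2) else 0 := by
  have hcont := continuous_highPart c hs E hf
  rw [← ofReal_setIntegral_cube (f := fun x => highPart c hs E f x ^ 2) (hcont.pow 2)
    fun _ => sq_nonneg _]
  have hsum := hasSum_neumannCoeff_sq c hs hf
  have h1 : ∫ x in cube c s, highPart c hs E f x ^ 2
      = ∑' k, if E < neumannEigenvalue s k then neumannCoeff c s f k ^ 2 else 0 := by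
    unfold highPart
    rw [integral_sub_proj_sq c hs hf]
    have h2 := (hasSum_sum_of_ne_finset_zero (L := .unconditional _) (f := fun k => if E < neumannEigenvalue s k then 0
      else neumannCoeff c s f k ^ 2) (s := lowModes d hs E) (fun k hk => by
        rw [mem_lowModes hs, not_le] at hk
        exact if_pos hk))
    have h3 : ∑ k ∈ lowModes d hs E, (if E < neumannEigenvalue s k then 0
        else neumannCoeff c s f k ^ 2) = ∑ k ∈ lowModes d hs E, neumannCoeff c s f k ^ 2 :=
      Finset.sum_congr rfl fun k hk => if_neg (not_lt.2 ((mem_lowModes hs).1 hk))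
    rw [h3] at h2
    refine ((hsum.sub h2).congr_fun ?_).tsum_eq.symm
    intro k
    split_ifs <;> simp
  rw [h1, ENNReal.ofReal_tsum_of_nonneg]
  · refine tsum_congr fun k => ?_
    split_ifs <;> simp
  · intro k
    split_ifs
    exacts [sq_nonneg _, le_rfl]
  · refine Summable.of_nonneg_of_le (fun k => ?_) (fun k => ?_) hsum.summable
    · split_ifs
      exacts [sq_nonneg _, le_rfl]
    · split_ifs
      exacts [le_rfl, sq_nonneg _]

theorem tsum_neumannEigenvalue_mul_le {d : ℕ} (hd : 1 ≤ d) (c : Fin d → ℝ) {s : ℝ} (hs : 0 < s)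
    {f : (Fin d → ℝ) → ℝ} (hf : ContDiff ℝ 1 f) :
    ∑' k, ENNReal.ofReal (neumannEigenvalue s k) * ENNReal.ofReal (neumannCoeff c s f k ^ 2)
      ≤ ∫⁻ x in cube c s, ENNReal.ofReal (∑ i, fderiv ℝ f x (Pi.single i 1) ^ 2) := by
  rw [← ofReal_setIntegral_cube]
  · rw [ENNReal.tsum_eq_iSup_sum]
    refine iSup_le fun S => ?_
    simp_rw [← ENNReal.ofReal_mul (neumannEigenvalue_nonneg s _)]
    rw [← ENNReal.ofReal_sum_of_nonneg fun k _ =>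
      mul_nonneg (neumannEigenvalue_nonneg s k) (sq_nonneg _)]
    exact ENNReal.ofReal_le_ofReal (sum_neumannEigenvalue_mul_sq_le hd c hs hf S)
  · exact continuous_finsetSum _ fun i _ =>
      (contDiff_fderiv_single (n := 0) (by simpa using hf) i).continuous.pow 2
  · exact fun x => Finset.sum_nonneg fun _ _ => sq_nonneg _

theorem sq_le_highPart_sq_add {d : ℕ} (hd : 1 ≤ d) (c : Fin d → ℝ) {s : ℝ} (hs : 0 < s)
    {f : (Fin d → ℝ) → ℝ} (hf : Continuous f) {E : ℝ} (hE : 0 ≤ E) (x : Fin d → ℝ) {θ : ℝ}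
    (hθ : 0 < θ) :
    f x ^ 2 ≤ (1 + θ) * highPart c hs E f x ^ 2
      + (1 + 1 / θ) * (√(1 / s ^ d) + √(d * (2 * √E / Real.pi) ^ d)) ^ 2
        * ∫ x in cube c s, f x ^ 2 := by
  have h := abs_proj_le hd c hs hf hE (lowModes d hs E) (fun k hk => (mem_lowModes hs).1 hk)
    ((mem_lowModes hs).2 (by simpa [neumannEigenvalue] using hE)) x
  set P := ∑ k ∈ lowModes d hs E, neumannCoeff c s f k * neumannMode c s k x with hP
  set B := √(1 / s ^ d) + √(d * (2 * √E / Real.pi) ^ d)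
  have hI : 0 ≤ ∫ x in cube c s, f x ^ 2 := integral_nonneg fun _ => sq_nonneg _
  have h2 : P ^ 2 ≤ B ^ 2 * ∫ x in cube c s, f x ^ 2 := by
    have := pow_le_pow_left₀ (abs_nonneg _) h 2
    rwa [sq_abs, mul_pow, Real.sq_sqrt hI] at this
  have hh : highPart c hs E f x = f x - P := rfl
  have h3 : f x ^ 2 ≤ (1 + θ) * (f x - P) ^ 2 + (1 + 1 / θ) * P ^ 2 := by
    have e : (1 + θ) * (f x - P) ^ 2 + (1 + 1 / θ) * P ^ 2 - f x ^ 2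
        = (θ * (f x - P) - P) ^ 2 / θ := by
      field_simp
      ring
    have : 0 ≤ (θ * (f x - P) - P) ^ 2 / θ := by positivity
    linarith
  rw [hh, mul_assoc]
  have : 0 ≤ 1 + 1 / θ := by positivity
  exact h3.trans (by gcongr)

section Parametric

variable {d : ℕ} {Ω : Type*} [MeasurableSpace Ω]

theorem measurable_neumannCoeff (c : Fin d → ℝ) (s : ℝ) {f : Ω → (Fin d → ℝ) → ℝ}
    (hm : Measurable (Function.uncurry f)) (k : Fin d → ℕ) :
    Measurable fun ω => neumannCoeff c s (f ω) k := by
  refine (StronglyMeasurable.integral_prod_right (f := fun ω x => f ω x * neumannMode c s k x)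
    (Measurable.stronglyMeasurable ?_)).measurable
  exact hm.mul ((continuous_neumannMode c s k).measurable.comp measurable_snd)

theorem measurable_highPart (c : Fin d → ℝ) {s : ℝ} (hs : 0 < s) (E : ℝ)
    {f : Ω → (Fin d → ℝ) → ℝ} (hm : Measurable (Function.uncurry f)) :
    Measurable fun p : Ω × (Fin d → ℝ) => highPart c hs E (f p.1) p.2 := by
  refine hm.sub (Finset.measurable_fun_sum _ fun k _ => ?_)
  exact ((measurable_neumannCoeff c s hm k).comp measurable_fst).mul
    ((continuous_neumannMode c s k).measurable.comp measurable_snd)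

theorem lintegral_sq_le_highPart (hd : 1 ≤ d) (c : Fin d → ℝ) {s : ℝ} (hs : 0 < s)
    (μ : Measure Ω) {f : Ω → (Fin d → ℝ) → ℝ} (hf : ∀ ω, Continuous (f ω))
    (hm : Measurable (Function.uncurry f)) {E : ℝ} (hE : 0 ≤ E) (x : Fin d → ℝ) {θ : ℝ}
    (hθ : 0 < θ) :
    ∫⁻ ω, ENNReal.ofReal (f ω x ^ 2) ∂μ
      ≤ ENNReal.ofReal (1 + θ) * ∫⁻ ω, ENNReal.ofReal (highPart c hs E (f ω) x ^ 2) ∂μ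
        + ENNReal.ofReal ((1 + 1 / θ) * (√(1 / s ^ d) + √(d * (2 * √E / Real.pi) ^ d)) ^ 2)
          * ∫⁻ ω, (∫⁻ x in cube c s, ENNReal.ofReal (f ω x ^ 2)) ∂μ := by
  have hmeas : Measurable fun ω => ENNReal.ofReal (highPart c hs E (f ω) x ^ 2) :=
    (((measurable_highPart c hs E hm).comp measurable_prodMk_right).pow_const 2).ennreal_ofReal
  rw [← lintegral_const_mul' _ _ ENNReal.ofReal_ne_top,
    ← lintegral_const_mul' _ _ ENNReal.ofReal_ne_top, ← lintegral_add_left (hmeas.const_mul _)]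
  refine lintegral_mono fun ω => ?_
  rw [← ofReal_setIntegral_cube (f := fun x => f ω x ^ 2) ((hf ω).pow 2) fun _ => sq_nonneg _,
    ← ENNReal.ofReal_mul (by positivity), ← ENNReal.ofReal_mul (by positivity),
    ← ENNReal.ofReal_add (by positivity)
      (mul_nonneg (by positivity) (integral_nonneg fun _ => sq_nonneg _))]
  exact ENNReal.ofReal_le_ofReal (sq_le_highPart_sq_add hd c hs (hf ω) hE x hθ)

/-- The kinetic energy on the cube dominates the integral over all energies of the mass above
that energy. -/
theorem lintegral_energy_highPart_le (hd : 1 ≤ d) (c : Fin d → ℝ) {s : ℝ} (hs : 0 < s)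
    (μ : Measure Ω) [SFinite μ] {f : Ω → (Fin d → ℝ) → ℝ} (hf : ∀ ω, ContDiff ℝ 1 (f ω))
    (hm : Measurable (Function.uncurry f)) :
    AEMeasurable (fun E => ∫⁻ x in cube c s, ∫⁻ ω, ENNReal.ofReal (highPart c hs E (f ω) x ^ 2) ∂μ)
      (volume.restrict (Set.Ioi 0)) ∧
    ∫⁻ E in Set.Ioi (0 : ℝ), ∫⁻ x in cube c s,
        ∫⁻ ω, ENNReal.ofReal (highPart c hs E (f ω) x ^ 2) ∂μ
      ≤ ∫⁻ ω, (∫⁻ x in cube c s,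
        ENNReal.ofReal (∑ i, fderiv ℝ (f ω) x (Pi.single i 1) ^ 2)) ∂μ := by
  set A : (Fin d → ℕ) → ENNReal := fun k => ∫⁻ ω, ENNReal.ofReal (neumannCoeff c s (f ω) k ^ 2) ∂μ
  have hmk (k : Fin d → ℕ) : Measurable fun ω => ENNReal.ofReal (neumannCoeff c s (f ω) k ^ 2) :=
    ((measurable_neumannCoeff c s hm k).pow_const 2).ennreal_ofReal
  have h1 (E : ℝ) : ∫⁻ x in cube c s, ∫⁻ ω, ENNReal.ofReal (highPart c hs E (f ω) x ^ 2) ∂μ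
      = ∑' k, (Set.Iio (neumannEigenvalue s k)).indicator (fun _ => A k) E := by
    rw [lintegral_lintegral_swap]
    · simp_rw [lintegral_highPart_sq c hs E (hf _).continuous]
      rw [lintegral_tsum]
      · refine tsum_congr fun k => ?_
        by_cases h : E < neumannEigenvalue s k
        · rw [Set.indicator_of_mem (Set.mem_Iio.2 h)]
          simp [h, A]
        · rw [Set.indicator_of_notMem (by simpa using h)]
          simp [h]
      · intro k
        split_ifs
        exacts [(hmk k).aemeasurable, aemeasurable_const]
    · exact ((((measurable_highPart c hs E hm).comp measurable_swap).pow_const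
        2).ennreal_ofReal).aemeasurable
  simp_rw [h1]
  have hind (k : Fin d → ℕ) :
      Measurable ((Set.Iio (neumannEigenvalue s k)).indicator fun _ => A k) :=
    measurable_const.indicator measurableSet_Iio
  refine ⟨(Measurable.tsum hind).aemeasurable, ?_⟩
  rw [lintegral_tsum fun k => (hind k).aemeasurable]
  calc _ = ∑' k, ENNReal.ofReal (neumannEigenvalue s k) * A k := by
        refine tsum_congr fun k => ?_
        rw [lintegral_indicator measurableSet_Iio, lintegral_const,
          Measure.restrict_restrict measurableSet_Iio, Measure.restrict_apply_univ, Set.inter_comm,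
          Set.Ioi_inter_Iio, Real.volume_Ioo, sub_zero, mul_comm]
    _ = ∫⁻ ω, ∑' k, ENNReal.ofReal (neumannEigenvalue s k)
          * ENNReal.ofReal (neumannCoeff c s (f ω) k ^ 2) ∂μ := by
        rw [lintegral_tsum fun k => ((hmk k).const_mul _).aemeasurable]
        refine tsum_congr fun k => ?_
        rw [lintegral_const_mul _ (hmk k)]
    _ ≤ _ := lintegral_mono fun ω => tsum_neumannEigenvalue_mul_le hd c hs (hf ω)

end Parametric

theorem max_sq_le_of_forall {q β : ℝ} (hβ : 0 < β) {r : ENNReal}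
    (h : ∀ θ : ℝ, 0 < θ → ENNReal.ofReal (q ^ 2)
      ≤ ENNReal.ofReal (1 + θ) * r + ENNReal.ofReal ((1 + 1 / θ) * β ^ 2)) :
    ENNReal.ofReal ((max (q - β) 0) ^ 2) ≤ r := by
  rcases le_or_gt q β with hq | hq
  · rw [max_eq_right (by linarith)]
    simp
  rw [max_eq_left (by linarith)]
  have hqβ : 0 < q - β := by linarith
  have hq0 : 0 < q := by linarith
  by_cases hr : r = ⊤
  · simp [hr]
  have h1 := h (β / (q - β)) (by positivity)
  have hr' : 0 ≤ r.toReal := ENNReal.toReal_nonneg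
  rw [← ENNReal.ofReal_toReal hr, ← ENNReal.ofReal_mul (by positivity),
    ← ENNReal.ofReal_add (by positivity) (by positivity),
    ENNReal.ofReal_le_ofReal_iff (by positivity)] at h1
  rw [← ENNReal.ofReal_toReal hr]
  refine ENNReal.ofReal_le_ofReal ?_
  have e1 : 1 + β / (q - β) = q / (q - β) := by field_simp; ring
  have e2 : (1 + 1 / (β / (q - β))) * β ^ 2 = q * β := by field_simp; ring
  rw [e1, e2] at h1
  have h2 : q * (q - β) ^ 2 ≤ q * r.toReal := by
    have h3 : q ^ 2 - q * β ≤ q / (q - β) * r.toReal := by linarith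
    have h4 := mul_le_mul_of_nonneg_right h3 hqβ.le
    have e3 : q / (q - β) * r.toReal * (q - β) = q * r.toReal := by field_simp
    rw [e3] at h4
    nlinarith
  exact le_of_mul_le_mul_left h2 hq0

section Density

variable {d : ℕ} {ι : Type*} {Ω : ι → Type*} [∀ i, MeasurableSpace (Ω i)]

theorem measurable_lintegral_sq {μ : ∀ i, Measure (Ω i)} [∀ i, SFinite (μ i)]
    {f : ∀ i, Ω i → (Fin d → ℝ) → ℝ} (hm : ∀ i, Measurable (Function.uncurry (f i))) (i : ι) :
    Measurable fun x => ∫⁻ ω, ENNReal.ofReal (f i ω x ^ 2) ∂μ i :=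
  Measurable.lintegral_prod_left' (f := fun p : Ω i × (Fin d → ℝ) => ENNReal.ofReal (f i p.1 p.2 ^ 2))
    ((hm i).pow_const 2).ennreal_ofReal

theorem lintegral_energy_density_le [Fintype ι] (hd : 1 ≤ d) (c : Fin d → ℝ) {s : ℝ} (hs : 0 < s)
    {μ : ∀ i, Measure (Ω i)} [∀ i, SFinite (μ i)] {f : ∀ i, Ω i → (Fin d → ℝ) → ℝ}
    (hf : ∀ i ω, ContDiff ℝ 1 (f i ω)) (hm : ∀ i, Measurable (Function.uncurry (f i)))
    {ρ : (Fin d → ℝ) → ℝ} (hρ0 : ∀ x, 0 ≤ ρ x)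
    (hρ : ∀ x, ENNReal.ofReal (ρ x) = ∑ i, ∫⁻ ω, ENNReal.ofReal (f i ω x ^ 2) ∂μ i)
    {M : ℝ} (hM : 0 < M) (hρM : ∫⁻ x in cube c s, ENNReal.ofReal (ρ x) = ENNReal.ofReal M) :
    ∫⁻ E in Set.Ioi (0 : ℝ), ∫⁻ x in cube c s, ENNReal.ofReal
        (max (√(ρ x) - (√(1 / s ^ d) + √(d * (2 * √E / Real.pi) ^ d)) * √M) 0 ^ 2)
      ≤ ∑ i, ∫⁻ ω, (∫⁻ x in cube c s,
        ENNReal.ofReal (∑ l, fderiv ℝ (f i ω) x (Pi.single l 1) ^ 2)) ∂μ i := by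
  have hmass : ∑ i, ∫⁻ ω, (∫⁻ x in cube c s, ENNReal.ofReal (f i ω x ^ 2)) ∂μ i
      = ENNReal.ofReal M := by
    simp_rw [← hρM, hρ]
    rw [lintegral_finsetSum _ fun i _ => measurable_lintegral_sq hm i]
    exact Finset.sum_congr rfl fun i _ =>
      lintegral_lintegral_swap ((hm i).pow_const 2).ennreal_ofReal.aemeasurable
  have hpt (E : ℝ) (hE : 0 < E) (x : Fin d → ℝ) : ENNReal.ofReal
      (max (√(ρ x) - (√(1 / s ^ d) + √(d * (2 * √E / Real.pi) ^ d)) * √M) 0 ^ 2)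
        ≤ ∑ i, ∫⁻ ω, ENNReal.ofReal (highPart c hs E (f i ω) x ^ 2) ∂μ i := by
    refine max_sq_le_of_forall (by positivity) fun θ hθ => ?_
    rw [Real.sq_sqrt (hρ0 x), hρ, mul_pow, Real.sq_sqrt hM.le, ← mul_assoc,
      ENNReal.ofReal_mul (by positivity), ← hmass, Finset.mul_sum, Finset.mul_sum,
      ← Finset.sum_add_distrib]
    exact Finset.sum_le_sum fun i _ =>
      lintegral_sq_le_highPart hd c hs (μ i) (fun ω => (hf i ω).continuous) (hm i) hE.le x hθ
  have hen (i : ι) := lintegral_energy_highPart_le hd c hs (μ i) (hf i) (hm i)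
  calc _ ≤ ∫⁻ E in Set.Ioi (0 : ℝ), ∑ i, ∫⁻ x in cube c s,
        ∫⁻ ω, ENNReal.ofReal (highPart c hs E (f i ω) x ^ 2) ∂μ i := by
        refine setLIntegral_mono' measurableSet_Ioi fun E hE => ?_
        rw [← lintegral_finsetSum]
        · exact lintegral_mono fun x => hpt E hE x
        · exact fun i _ => Measurable.lintegral_prod_left'
            (((measurable_highPart c hs E (hm i)).pow_const 2).ennreal_ofReal)
    _ = ∑ i, ∫⁻ E in Set.Ioi (0 : ℝ), ∫⁻ x in cube c s,
        ∫⁻ ω, ENNReal.ofReal (highPart c hs E (f i ω) x ^ 2) ∂μ i :=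
        lintegral_finsetSum' _ fun i _ => (hen i).1
    _ ≤ _ := Finset.sum_le_sum fun i _ => (hen i).2

end Density

theorem integral_sub_mul_rpow_sq {d a b : ℝ} (hd : 0 < d) (ha : 0 < a) (hb : 0 < b) :
    ∫ E in (0 : ℝ)..(a / b) ^ (4 / d), (a - b * E ^ (d / 4)) ^ 2
      = d ^ 2 / ((d + 2) * (d + 4)) * a ^ (2 * (d + 2) / d) * b ^ (-4 / d) := by
  have hab : 0 < a / b := by positivity
  set e := (a / b) ^ (4 / d) with he
  have he0 : 0 < e := by positivity
  have he1 : e ^ (d / 4) = a / b := by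
    rw [he, ← Real.rpow_mul hab.le]
    have : 4 / d * (d / 4) = 1 := by field_simp
    rw [this, Real.rpow_one]
  have he2 : e ^ (d / 2) = (a / b) ^ 2 := by
    rw [← he1, ← Real.rpow_natCast, ← Real.rpow_mul he0.le]
    congr 1
    push_cast
    ring
  have hmain : e = a ^ (4 / d) * b ^ (-4 / d) := by
    rw [he, Real.div_rpow ha.le hb.le, neg_div, Real.rpow_neg hb.le]
    rfl
  have ha2 : a ^ (2 * (d + 2) / d) = a ^ 2 * a ^ (4 / d) := by
    rw [← Real.rpow_natCast, ← Real.rpow_add ha]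
    congr 1
    field_simp
    push_cast
    ring
  have h1 : ∫ E in (0 : ℝ)..e, (a - b * E ^ (d / 4)) ^ 2
      = ∫ E in (0 : ℝ)..e, (a ^ 2 - 2 * a * b * E ^ (d / 4) + b ^ 2 * E ^ (d / 2)) := by
    refine intervalIntegral.integral_congr fun E hE => ?_
    rw [Set.uIcc_of_le he0.le] at hE
    have : E ^ (d / 2) = (E ^ (d / 4)) ^ 2 := by
      rw [← Real.rpow_natCast, ← Real.rpow_mul hE.1]
      congr 1
      push_cast
      ring
    simp only [this]
    ring
  have i1 : IntervalIntegrable (fun E : ℝ => E ^ (d / 4)) volume 0 e :=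
    intervalIntegral.intervalIntegrable_rpow' (by linarith [div_pos hd (four_pos (α := ℝ))])
  have i2 : IntervalIntegrable (fun E : ℝ => E ^ (d / 2)) volume 0 e :=
    intervalIntegral.intervalIntegrable_rpow' (by linarith [div_pos hd (two_pos (α := ℝ))])
  rw [h1, intervalIntegral.integral_add
      ((intervalIntegrable_const).sub (i1.const_mul _)) (i2.const_mul _),
    intervalIntegral.integral_sub intervalIntegrable_const (i1.const_mul _),
    intervalIntegral.integral_const, intervalIntegral.integral_const_mul,
    intervalIntegral.integral_const_mul,
    integral_rpow (Or.inl (by linarith [div_pos hd (four_pos (α := ℝ))])),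
    integral_rpow (Or.inl (by linarith [div_pos hd (two_pos (α := ℝ))])),
    Real.zero_rpow (by positivity), Real.zero_rpow (by positivity),
    Real.rpow_add he0, Real.rpow_add he0, he1, he2, Real.rpow_one, ha2]
  have hR : d ^ 2 / ((d + 2) * (d + 4)) * (a ^ 2 * a ^ (4 / d)) * b ^ (-4 / d)
      = d ^ 2 / ((d + 2) * (d + 4)) * a ^ 2 * e := by
    rw [hmain]
    ring
  rw [hR, smul_eq_mul]
  clear_value e
  field_simp
  ring

theorem le_lintegral_max_sub_mul_rpow_sq {d b : ℝ} (hd : 0 < d) (hb : 0 < b) (t : ℝ) :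
    ENNReal.ofReal (d ^ 2 / ((d + 2) * (d + 4)) * max t 0 ^ (2 * (d + 2) / d) * b ^ (-4 / d))
      ≤ ∫⁻ E in Set.Ioi (0 : ℝ), ENNReal.ofReal (max (t - b * E ^ (d / 4)) 0 ^ 2) := by
  rcases le_or_gt t 0 with ht | ht
  · rw [max_eq_right ht, Real.zero_rpow (by positivity)]
    simp
  rw [max_eq_left ht.le, ← integral_sub_mul_rpow_sq hd ht hb]
  have htb : 0 < t / b := by positivity
  have he0 : 0 ≤ (t / b) ^ (4 / d) := by positivity
  have hcont : Continuous fun E : ℝ => (t - b * E ^ (d / 4)) ^ 2 := by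
    have := Real.continuous_rpow_const (q := d / 4) (by positivity)
    fun_prop
  rw [intervalIntegral.integral_of_le he0,
    ofReal_integral_eq_lintegral_ofReal hcont.integrableOn_Ioc
      (Filter.Eventually.of_forall fun _ => sq_nonneg _)]
  refine (setLIntegral_mono' measurableSet_Ioc fun E hE => ?_).trans
    (lintegral_mono_set Set.Ioc_subset_Ioi_self)
  have h1 : E ^ (d / 4) ≤ t / b := by
    calc E ^ (d / 4) ≤ ((t / b) ^ (4 / d)) ^ (d / 4) :=
          Real.rpow_le_rpow hE.1.le hE.2 (by positivity)
      _ = t / b := by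
          rw [← Real.rpow_mul htb.le]
          have : 4 / d * (d / 4) = 1 := by field_simp
          rw [this, Real.rpow_one]
  have h2 : b * E ^ (d / 4) ≤ t := by rwa [le_div_iff₀' hb] at h1
  rw [max_eq_left (by linarith)]

theorem sqrt_weyl_eq {d : ℕ} {E M : ℝ} (hE : 0 ≤ E) :
    √(d * (2 * √E / Real.pi) ^ d) * √M = √(d * (2 / Real.pi) ^ d) * √M * E ^ ((d : ℝ) / 4) := by
  have hp := Real.pi_pos
  have h1 : (d : ℝ) * (2 * √E / Real.pi) ^ d = d * (2 / Real.pi) ^ d * (E ^ ((d : ℝ) / 4)) ^ 2 := by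
    have : (E ^ ((d : ℝ) / 4)) ^ 2 = √E ^ d := by
      rw [Real.sqrt_eq_rpow, ← Real.rpow_natCast, ← Real.rpow_natCast, ← Real.rpow_mul hE,
        ← Real.rpow_mul hE]
      congr 1
      push_cast
      ring
    rw [this, mul_div_right_comm, mul_pow]
    ring
  rw [h1, Real.sqrt_mul (by positivity), Real.sqrt_sq (by positivity)]
  ring

theorem weyl_rpow_eq {d : ℕ} (hd : 1 ≤ d) {M : ℝ} (hM : 0 < M) :
    (√(d * (2 / Real.pi) ^ d) * √M) ^ (-4 / (d : ℝ))
      = Real.pi ^ 2 / 4 * (d : ℝ) ^ (-2 / (d : ℝ)) / M ^ (2 / (d : ℝ)) := by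
  have hp := Real.pi_pos
  have hd0 : (0 : ℝ) < d := by exact_mod_cast hd
  rw [← Real.sqrt_mul (by positivity), Real.sqrt_eq_rpow, ← Real.rpow_mul (by positivity)]
  have : 1 / 2 * (-4 / (d : ℝ)) = -2 / d := by ring
  rw [this, Real.mul_rpow (by positivity) hM.le, Real.mul_rpow hd0.le (by positivity),
    ← Real.rpow_natCast (2 / Real.pi), ← Real.rpow_mul (by positivity)]
  have : (d : ℝ) * (-2 / d) = -(2 : ℕ) := by
    push_cast
    field_simp
  rw [this, Real.rpow_neg (by positivity), Real.rpow_natCast, neg_div, Real.rpow_neg hM.le]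
  field_simp
  norm_num

/-- The uncertainty bound on a cube for the density of a family of functions. -/
theorem uncertainty_of_family {d : ℕ} {ι : Type*} [Fintype ι] {Ω : ι → Type*}
    [∀ i, MeasurableSpace (Ω i)] (hd : 1 ≤ d) (c : Fin d → ℝ) {s : ℝ} (hs : 0 < s)
    {μ : ∀ i, Measure (Ω i)} [∀ i, SFinite (μ i)] {f : ∀ i, Ω i → (Fin d → ℝ) → ℝ}
    (hf : ∀ i ω, ContDiff ℝ 1 (f i ω)) (hm : ∀ i, Measurable (Function.uncurry (f i)))
    {ρ : (Fin d → ℝ) → ℝ} (hρ0 : ∀ x, 0 ≤ ρ x)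
    (hρ : ∀ x, ENNReal.ofReal (ρ x) = ∑ i, ∫⁻ ω, ENNReal.ofReal (f i ω x ^ 2) ∂μ i)
    {M : ℝ} (hM : 0 < M) (hρM : ∫⁻ x in cube c s, ENNReal.ofReal (ρ x) = ENNReal.ofReal M) :
    ENNReal.ofReal ((Real.pi ^ 2 / 4 * (d : ℝ) ^ ((2 : ℝ) - 2 / (d : ℝ))
          / (((d : ℝ) + 2) * ((d : ℝ) + 4))) / M ^ ((2 : ℝ) / (d : ℝ)))
        * ∫⁻ x in cube c s, ENNReal.ofReal
          (max (√(ρ x) - √(M / s ^ d)) 0 ^ (2 * ((d : ℝ) + 2) / (d : ℝ)))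
      ≤ ∑ i, ∫⁻ ω, (∫⁻ x in cube c s,
        ENNReal.ofReal (∑ l, fderiv ℝ (f i ω) x (Pi.single l 1) ^ 2)) ∂μ i := by
  have hp := Real.pi_pos
  have hd0 : (0 : ℝ) < d := by exact_mod_cast hd
  have hρm : Measurable ρ := by
    have h : ρ = fun x => (∑ i, ∫⁻ ω, ENNReal.ofReal (f i ω x ^ 2) ∂μ i).toReal := by
      ext x
      rw [← hρ, ENNReal.toReal_ofReal (hρ0 x)]
    rw [h]
    exact (Finset.measurable_fun_sum _ fun i _ => measurable_lintegral_sq hm i).ennreal_toReal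
  refine le_trans ?_ (lintegral_energy_density_le hd c hs hf hm hρ0 hρ hM hρM)
  rw [← lintegral_const_mul' _ _ ENNReal.ofReal_ne_top, lintegral_lintegral_swap]
  · refine lintegral_mono fun x => ?_
    set b := √(d * (2 / Real.pi) ^ d) * √M with hb
    have hb0 : 0 < b := by positivity
    refine le_trans (le_of_eq ?_) ((le_lintegral_max_sub_mul_rpow_sq hd0 hb0
      (√(ρ x) - √(M / s ^ d))).trans (le_of_eq ?_))
    · rw [← ENNReal.ofReal_mul (by positivity), hb, weyl_rpow_eq hd hM, sub_eq_add_neg,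
        Real.rpow_add hd0, ← neg_div]
      norm_num
      congr 1
      ring
    · refine setLIntegral_congr_fun measurableSet_Ioi fun E hE => ?_
      have h1 : √(1 / s ^ d) * √M = √(M / s ^ d) := by
        rw [← Real.sqrt_mul (by positivity)]
        congr 1
        ring
      simp only [add_mul, h1, sqrt_weyl_eq (le_of_lt hE), ← hb, sub_sub]
  · refine Measurable.aemeasurable (Measurable.ennreal_ofReal (Measurable.pow_const ?_ 2))
    have : Measurable fun p : ℝ × (Fin d → ℝ) => ρ p.2 := hρm.comp measurable_snd
    fun_prop

section Transfer

variable {d N : ℕ}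

/-- The configuration with `y` at position `j` and `z` elsewhere. -/
def insertAt (j : Fin N) (y : EuclideanSpace ℝ (Fin d))
    (z : {k : Fin N // k ≠ j} → EuclideanSpace ℝ (Fin d)) : Fin N → EuclideanSpace ℝ (Fin d) :=
  fun k => if h : k = j then y else z ⟨k, h⟩

theorem insertAt_same (j : Fin N) (y : EuclideanSpace ℝ (Fin d))
    (z : {k : Fin N // k ≠ j} → EuclideanSpace ℝ (Fin d)) : insertAt j y z j = y := by
  simp [insertAt]

theorem continuous_insertAt (j : Fin N) : Continuous fun p : EuclideanSpace ℝ (Fin d) ×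
    ({k : Fin N // k ≠ j} → EuclideanSpace ℝ (Fin d)) => insertAt j p.1 p.2 := by
  refine continuous_pi fun k => ?_
  unfold insertAt
  split_ifs
  exacts [continuous_fst, (continuous_apply _).comp continuous_snd]

theorem insertAt_eq_add (j : Fin N) (y : EuclideanSpace ℝ (Fin d))
    (z : {k : Fin N // k ≠ j} → EuclideanSpace ℝ (Fin d)) :
    insertAt j y z = Pi.single j y + insertAt j 0 z := by
  ext1 k
  by_cases h : k = j
  · subst h
    simp [insertAt]
  · simp [insertAt, h]

theorem isClosedEmbedding_insertAt (j : Fin N) (y : EuclideanSpace ℝ (Fin d)) :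
    Topology.IsClosedEmbedding (insertAt j y) := by
  refine Function.LeftInverse.isClosedEmbedding (f := fun x k => x k.1) (fun z => ?_)
    (by fun_prop) ((continuous_insertAt j).comp (by fun_prop : Continuous fun z => (y, z)))
  ext1 k
  simp [insertAt, k.2]

theorem measurePreserving_insertAt (j : Fin N) :
    MeasurePreserving (fun p : EuclideanSpace ℝ (Fin d) ×
      ({k : Fin N // k ≠ j} → EuclideanSpace ℝ (Fin d)) => insertAt j p.1 p.2) := by
  have h1 := (measurePreserving_piEquivPiSubtypeProd
    (fun _ : Fin N => (volume : Measure (EuclideanSpace ℝ (Fin d)))) (· = j)).symm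
  have h2 : MeasurePreserving
      (MeasurableEquiv.funUnique {k : Fin N // k = j} (EuclideanSpace ℝ (Fin d))).symm volume
      (@Measure.pi _ _ (Subtype.fintype (· = j)) _ fun _ => volume) := by
    convert (measurePreserving_funUnique (volume : Measure (EuclideanSpace ℝ (Fin d)))
      {k : Fin N // k = j}).symm
    rfl
  exact h1.comp (h2.prod (MeasurePreserving.id _))

/-- `u` as a function of the `j`-th coordinate. -/
def fiber (u : (Fin N → EuclideanSpace ℝ (Fin d)) → ℂ) (j : Fin N)
    (z : {k : Fin N // k ≠ j} → EuclideanSpace ℝ (Fin d)) (x : Fin d → ℝ) : ℂ :=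
  u (insertAt j (WithLp.toLp 2 x) z)

theorem continuous_insertAt_toLp (j : Fin N) :
    Continuous fun p : ({k : Fin N // k ≠ j} → EuclideanSpace ℝ (Fin d)) × (Fin d → ℝ) =>
      insertAt j (WithLp.toLp 2 p.2) p.1 :=
  (continuous_insertAt j).comp
    (((PiLp.continuous_toLp 2 _).comp continuous_snd).prodMk continuous_fst)

theorem hasFDerivAt_insertAt_toLp (j : Fin N)
    (z : {k : Fin N // k ≠ j} → EuclideanSpace ℝ (Fin d)) (x : Fin d → ℝ) :
    HasFDerivAt (fun x => insertAt j (WithLp.toLp 2 x) z)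
      ((ContinuousLinearMap.single ℝ (fun _ : Fin N => EuclideanSpace ℝ (Fin d)) j).comp
        (PiLp.continuousLinearEquiv 2 ℝ fun _ : Fin d => ℝ).symm.toContinuousLinearMap) x := by
  rw [funext fun x : Fin d → ℝ => insertAt_eq_add j (WithLp.toLp 2 x) z]
  exact ((ContinuousLinearMap.single ℝ (fun _ : Fin N => EuclideanSpace ℝ (Fin d)) j).comp
    (PiLp.continuousLinearEquiv 2 ℝ fun _ : Fin d =>
      ℝ).symm.toContinuousLinearMap).hasFDerivAt.add_const _

theorem contDiff_fiber {u : (Fin N → EuclideanSpace ℝ (Fin d)) → ℂ} (hu : ContDiff ℝ 1 u)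
    (j : Fin N) (z : {k : Fin N // k ≠ j} → EuclideanSpace ℝ (Fin d)) :
    ContDiff ℝ 1 (fiber u j z) := by
  refine hu.comp ?_
  rw [funext fun x : Fin d → ℝ => insertAt_eq_add j (WithLp.toLp 2 x) z]
  exact ((ContinuousLinearMap.single ℝ (fun _ : Fin N => EuclideanSpace ℝ (Fin d)) j).comp
    (PiLp.continuousLinearEquiv 2 ℝ fun _ : Fin d => ℝ).symm.toContinuousLinearMap).contDiff.add
      contDiff_const

theorem fderiv_comp_fiber {u : (Fin N → EuclideanSpace ℝ (Fin d)) → ℂ} (hu : ContDiff ℝ 1 u)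
    (L : ℂ →L[ℝ] ℝ) (j : Fin N) (z : {k : Fin N // k ≠ j} → EuclideanSpace ℝ (Fin d))
    (x : Fin d → ℝ) (l : Fin d) :
    fderiv ℝ (fun x => L (fiber u j z x)) x (Pi.single l 1)
      = L (fderiv ℝ u (insertAt j (WithLp.toLp 2 x) z)
          (Pi.single j (EuclideanSpace.single l 1))) := by
  have h := L.hasFDerivAt.comp x (((hu.differentiable one_ne_zero
    (insertAt j (WithLp.toLp 2 x) z)).hasFDerivAt).comp x (hasFDerivAt_insertAt_toLp j z x))
  exact congrArg (fun T => T (Pi.single l 1)) h.fderiv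

/-- The real and the imaginary part. -/
noncomputable def reIm (b : Bool) : ℂ →L[ℝ] ℝ := if b then Complex.reCLM else Complex.imCLM

theorem sum_reIm_sq (w : ℂ) : ∑ b, reIm b w ^ 2 = ‖w‖ ^ 2 := by
  simp only [Fintype.sum_bool, Complex.sq_norm, Complex.normSq_apply]
  simp [reIm, sq]

theorem ofReal_densityAt {u : (Fin N → EuclideanSpace ℝ (Fin d)) → ℂ} (hu : Continuous u)
    (hcs : HasCompactSupport u) (j : Fin N) (x : Fin d → ℝ) :
    ENNReal.ofReal (densityAt u j (WithLp.toLp 2 x))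
      = ∑ b, ∫⁻ z, ENNReal.ofReal (reIm b (fiber u j z x) ^ 2) := by
  have hemb := isClosedEmbedding_insertAt j (WithLp.toLp 2 x)
  have hc : Continuous fun z => fiber u j z x := hu.comp hemb.continuous
  have hs : HasCompactSupport fun z => fiber u j z x := hcs.comp_isClosedEmbedding hemb
  have hInt : Integrable fun z => ‖fiber u j z x‖ ^ 2 :=
    Continuous.integrable_of_hasCompactSupport (by fun_prop)
      (hs.comp_left (g := fun w => ‖w‖ ^ 2) (by simp))
  have h : densityAt u j (WithLp.toLp 2 x) = ∫ z, ‖fiber u j z x‖ ^ 2 := rfl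
  rw [h, ofReal_integral_eq_lintegral_ofReal hInt (Filter.Eventually.of_forall fun _ => sq_nonneg _),
    ← lintegral_finsetSum]
  · refine lintegral_congr fun z => ?_
    rw [← sum_reIm_sq, ENNReal.ofReal_sum_of_nonneg fun _ _ => sq_nonneg _]
  · exact fun b _ => Measurable.ennreal_ofReal (Continuous.measurable (by fun_prop))

theorem toLp_preimage_eq_cube {c : EuclideanSpace ℝ (Fin d)} {s : ℝ}
    {Q : Set (EuclideanSpace ℝ (Fin d))}
    (hQ : Q = {y : EuclideanSpace ℝ (Fin d) | ∀ i, y i ∈ Set.Icc (c i) (c i + s)}) :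
    WithLp.toLp 2 ⁻¹' Q = cube (fun i => c i) s := by
  ext x
  simp [hQ, cube, Pi.le_def, forall_and]

theorem setLIntegral_cube_eq {c : EuclideanSpace ℝ (Fin d)} {s : ℝ}
    {Q : Set (EuclideanSpace ℝ (Fin d))}
    (hQ : Q = {y : EuclideanSpace ℝ (Fin d) | ∀ i, y i ∈ Set.Icc (c i) (c i + s)})
    (F : EuclideanSpace ℝ (Fin d) → ENNReal) :
    ∫⁻ x in cube (fun i => c i) s, F (WithLp.toLp 2 x) = ∫⁻ y in Q, F y := by
  rw [← toLp_preimage_eq_cube hQ]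
  exact (PiLp.volume_preserving_toLp (Fin d)).setLIntegral_comp_preimage_emb
    (MeasurableEquiv.toLp 2 _).measurableEmbedding F Q

theorem measurableSet_of_eq_cube {c : EuclideanSpace ℝ (Fin d)} {s : ℝ}
    {Q : Set (EuclideanSpace ℝ (Fin d))}
    (hQ : Q = {y : EuclideanSpace ℝ (Fin d) | ∀ i, y i ∈ Set.Icc (c i) (c i + s)}) :
    MeasurableSet Q := by
  rw [← (MeasurableEquiv.toLp 2 (Fin d → ℝ)).measurableSet_preimage]
  exact toLp_preimage_eq_cube hQ ▸ measurableSet_cube _ s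

theorem integrable_mul_indicator {F : (Fin N → EuclideanSpace ℝ (Fin d)) → ℝ}
    (hF : Continuous F) (hcs : HasCompactSupport F) {Q : Set (EuclideanSpace ℝ (Fin d))}
    (hQ : MeasurableSet Q) (j : Fin N) :
    Integrable fun x => F x * Q.indicator (fun _ => (1 : ℝ)) (x j) := by
  refine (hF.integrable_of_hasCompactSupport hcs).mul_bdd (c := 1) ?_ ?_
  · exact ((measurable_const.indicator hQ).comp (measurable_pi_apply j)).aestronglyMeasurable
  · refine Filter.Eventually.of_forall fun x => ?_
    by_cases h : x j ∈ Q <;> simp [h]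

theorem lintegral_fiber_cube {c : EuclideanSpace ℝ (Fin d)} {s : ℝ}
    {Q : Set (EuclideanSpace ℝ (Fin d))}
    (hQ : Q = {y : EuclideanSpace ℝ (Fin d) | ∀ i, y i ∈ Set.Icc (c i) (c i + s)})
    {F : (Fin N → EuclideanSpace ℝ (Fin d)) → ℝ} (hF : Continuous F) (hcs : HasCompactSupport F)
    (h0 : ∀ x, 0 ≤ F x) (j : Fin N) :
    ∫⁻ z, ∫⁻ x in cube (fun i => c i) s, ENNReal.ofReal (F (insertAt j (WithLp.toLp 2 x) z))
      = ENNReal.ofReal (∫ x, F x * Q.indicator (fun _ => (1 : ℝ)) (x j)) := by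
  have hQm := measurableSet_of_eq_cube hQ
  have hmeas : Measurable fun x : Fin N → EuclideanSpace ℝ (Fin d) =>
      ENNReal.ofReal (F x * Q.indicator (fun _ => (1 : ℝ)) (x j)) :=
    (hF.measurable.mul ((measurable_const.indicator hQm).comp
      (measurable_pi_apply j))).ennreal_ofReal
  rw [ofReal_integral_eq_lintegral_ofReal (integrable_mul_indicator hF hcs hQm j)
      (Filter.Eventually.of_forall fun x =>
        mul_nonneg (h0 x) (Set.indicator_nonneg (fun _ _ => zero_le_one) _)),
    ← (measurePreserving_insertAt j).lintegral_comp hmeas, Measure.volume_eq_prod,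
    lintegral_prod_symm' (fun p : EuclideanSpace ℝ (Fin d) × _ =>
      ENNReal.ofReal (F (insertAt j p.1 p.2) * Q.indicator (fun _ => 1) (insertAt j p.1 p.2 j)))
      (hmeas.comp (continuous_insertAt j).measurable)]
  refine lintegral_congr fun z => ?_
  rw [setLIntegral_cube_eq hQ fun y => ENNReal.ofReal (F (insertAt j y z)),
    ← lintegral_indicator hQm]
  refine lintegral_congr fun y => ?_
  by_cases h : y ∈ Q <;> simp [h, insertAt_same]

theorem hasCompactSupport_sum_sq_fderiv {u : (Fin N → EuclideanSpace ℝ (Fin d)) → ℂ}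
    (hcs : HasCompactSupport u) (j : Fin N) {n : ℂ → ℝ} (hn : n 0 = 0) :
    HasCompactSupport fun x => ∑ l : Fin d,
      n (fderiv ℝ u x (Pi.single j (EuclideanSpace.single l (1 : ℝ)))) ^ 2 :=
  (hcs.fderiv ℝ).comp_left
    (g := fun T : (Fin N → EuclideanSpace ℝ (Fin d)) →L[ℝ] ℂ => ∑ l : Fin d,
      n (T (Pi.single j (EuclideanSpace.single l (1 : ℝ)))) ^ 2) (by simp [hn])

/-- The kinetic energy on a cube, split into fibers and into real and imaginary parts. -/
theorem lintegral_fiber_energy_eq {c : EuclideanSpace ℝ (Fin d)} {s : ℝ}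
    {Q : Set (EuclideanSpace ℝ (Fin d))}
    (hQ : Q = {y : EuclideanSpace ℝ (Fin d) | ∀ i, y i ∈ Set.Icc (c i) (c i + s)})
    {u : (Fin N → EuclideanSpace ℝ (Fin d)) → ℂ} (hu : ContDiff ℝ 1 u)
    (hcs : HasCompactSupport u) (j : Fin N) :
    ∑ b, ∫⁻ z, ∫⁻ x in cube (fun i => c i) s, ENNReal.ofReal
        (∑ l, fderiv ℝ (fun x => reIm b (fiber u j z x)) x (Pi.single l 1) ^ 2)
      = ENNReal.ofReal (∫ x : Fin N → EuclideanSpace ℝ (Fin d),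
        (∑ l : Fin d, ‖fderiv ℝ u x (Pi.single j (EuclideanSpace.single l (1 : ℝ)))‖ ^ 2) *
          Set.indicator Q (fun _ => (1 : ℝ)) (x j)) := by
  have hQm := measurableSet_of_eq_cube hQ
  have hD (l : Fin d) : Continuous fun x =>
      fderiv ℝ u x (Pi.single j (EuclideanSpace.single l (1 : ℝ))) :=
    (hu.continuous_fderiv one_ne_zero).clm_apply continuous_const
  have hF (b : Bool) : Continuous fun x => ∑ l : Fin d,
      reIm b (fderiv ℝ u x (Pi.single j (EuclideanSpace.single l 1))) ^ 2 :=
    continuous_finsetSum _ fun l _ => ((reIm b).continuous.comp (hD l)).pow 2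
  have hS (b : Bool) := hasCompactSupport_sum_sq_fderiv hcs j (n := reIm b) (map_zero _)
  simp_rw [fderiv_comp_fiber hu]
  have h1 (b : Bool) := lintegral_fiber_cube hQ (hF b) (hS b)
    (fun x => Finset.sum_nonneg fun _ _ => sq_nonneg _) j
  simp_rw [h1]
  rw [← ENNReal.ofReal_sum_of_nonneg fun b _ => integral_nonneg fun x =>
      mul_nonneg (Finset.sum_nonneg fun _ _ => sq_nonneg _)
        (Set.indicator_nonneg (fun _ _ => zero_le_one) _),
    ← integral_finsetSum _ fun b _ => integrable_mul_indicator (hF b) (hS b) hQm j]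
  simp_rw [← Finset.sum_mul, ← sum_reIm_sq]
  congr 2
  ext x
  rw [Finset.sum_comm]

end Transfer

/-- **Local uncertainty on a cube.** For any `N`-particle wave function
`u ∈ C_c^∞((ℝ^d)^N)` with one-particle density `ρ = ∑_j densityAt u j` and a cube
`Q` of side `s` (volume `s^d`) with `∫_Q ρ > 0`,
`∑_j ∫ ‖∇_j u‖² χ_Q(x_j) ≥ (C'_d/(∫_Q ρ)^{2/d}) ∫_Q [ρ^{1/2} - (∫_Q ρ/|Q|)^{1/2}]₊^{2(d+2)/d}`
with `C'_d = (π²/4) d^{2-2/d}/((d+2)(d+4))` (`= π²/60` for `d = 1`). -/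
theorem uncertainty_on_cube
    (d N : ℕ) (hd : 1 ≤ d) (hN : 1 ≤ N)
    (c : EuclideanSpace ℝ (Fin d)) (s : ℝ) (hs : 0 < s)
    (Q : Set (EuclideanSpace ℝ (Fin d)))
    (hQ : Q = {y : EuclideanSpace ℝ (Fin d) | ∀ i, y i ∈ Set.Icc (c i) (c i + s)})
    (u : (Fin N → EuclideanSpace ℝ (Fin d)) → ℂ)
    (hu : ContDiff ℝ (⊤ : ℕ∞) u) (hcs : HasCompactSupport u)
    (hpos : 0 < ∫ y in Q, ∑ j : Fin N, densityAt u j y) :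
    (∑ j : Fin N, ∫ x : Fin N → EuclideanSpace ℝ (Fin d),
        (∑ i : Fin d,
          ‖fderiv ℝ u x (Pi.single j (EuclideanSpace.single i (1 : ℝ)))‖ ^ 2) *
          Set.indicator Q (fun _ => (1 : ℝ)) (x j))
      ≥ (Real.pi ^ 2 / 4 * (d : ℝ) ^ ((2 : ℝ) - 2 / (d : ℝ)) /
            (((d : ℝ) + 2) * ((d : ℝ) + 4))) /
          (∫ y in Q, ∑ j : Fin N, densityAt u j y) ^ ((2 : ℝ) / (d : ℝ)) *
        ∫ y in Q,
          (max (Real.sqrt (∑ j : Fin N, densityAt u j y)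
            - Real.sqrt ((∫ z in Q, ∑ j : Fin N, densityAt u j z) / s ^ d)) 0)
          ^ ((2 * ((d : ℝ) + 2)) / (d : ℝ)) := by
  have hu1 : ContDiff ℝ 1 u := hu.of_le (by exact_mod_cast le_top)
  have hdens (j : Fin N) (y : EuclideanSpace ℝ (Fin d)) : 0 ≤ densityAt u j y :=
    integral_nonneg fun _ => sq_nonneg _
  set ρ : EuclideanSpace ℝ (Fin d) → ℝ := fun y => ∑ j : Fin N, densityAt u j y with hρ
  have hρ0 (y : EuclideanSpace ℝ (Fin d)) : 0 ≤ ρ y := Finset.sum_nonneg fun j _ => hdens j y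
  have hInt : IntegrableOn ρ Q := by
    by_contra h
    exact hpos.ne' (integral_undef h)
  set M := ∫ y in Q, ρ y
  have hmass : ∫⁻ x in cube (fun i => c i) s, ENNReal.ofReal (ρ (WithLp.toLp 2 x))
      = ENNReal.ofReal M := by
    rw [setLIntegral_cube_eq hQ fun y => ENNReal.ofReal (ρ y)]
    exact (ofReal_integral_eq_lintegral_ofReal hInt (Filter.Eventually.of_forall hρ0)).symm
  have key := uncertainty_of_family (ι := Fin N × Bool)
    (Ω := fun p => {k : Fin N // k ≠ p.1} → EuclideanSpace ℝ (Fin d)) hd (fun i => c i) hs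
    (μ := fun _ => volume) (f := fun p z x => reIm p.2 (fiber u p.1 z x))
    (fun p z => (reIm p.2).contDiff.comp (contDiff_fiber hu1 p.1 z))
    (fun p => ((reIm p.2).continuous.comp
      (hu1.continuous.comp (continuous_insertAt_toLp p.1))).measurable)
    (ρ := fun x => ρ (WithLp.toLp 2 x)) (fun x => hρ0 _)
    (fun x => by
      rw [hρ, ENNReal.ofReal_sum_of_nonneg fun j _ => hdens j _, Fintype.sum_prod_type]
      exact Finset.sum_congr rfl fun j _ => ofReal_densityAt hu1.continuous hcs j x)
    hpos hmass
  rw [Fintype.sum_prod_type] at key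
  simp_rw [lintegral_fiber_energy_eq hQ hu1 hcs] at key
  have hT (j : Fin N) : 0 ≤ ∫ x : Fin N → EuclideanSpace ℝ (Fin d),
      (∑ l : Fin d, ‖fderiv ℝ u x (Pi.single j (EuclideanSpace.single l (1 : ℝ)))‖ ^ 2) *
        Set.indicator Q (fun _ => (1 : ℝ)) (x j) :=
    integral_nonneg fun x => mul_nonneg (Finset.sum_nonneg fun _ _ => sq_nonneg _)
      (Set.indicator_nonneg (fun _ _ => zero_le_one) _)
  rw [← ENNReal.ofReal_sum_of_nonneg fun j _ => hT j,
    setLIntegral_cube_eq hQ fun y => ENNReal.ofReal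
      (max (√(ρ y) - √(M / s ^ d)) 0 ^ (2 * ((d : ℝ) + 2) / (d : ℝ)))] at key
  have hT0 := Finset.sum_nonneg fun j (_ : j ∈ Finset.univ) => hT j
  by_cases hg : IntegrableOn
      (fun y => max (√(ρ y) - √(M / s ^ d)) 0 ^ (2 * ((d : ℝ) + 2) / (d : ℝ))) Q
  · rw [← ofReal_integral_eq_lintegral_ofReal hg (Filter.Eventually.of_forall fun y =>
        Real.rpow_nonneg (le_max_right _ _) _),
      ← ENNReal.ofReal_mul (by positivity)] at key
    exact (ENNReal.ofReal_le_ofReal_iff hT0).1 key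
  · rw [integral_undef hg, mul_zero]
    exact hT0
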